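/- arXiv:1103.3262 — 8 statements merged into one kernel-verified Lean document; each statement's English description precedes it below -/
import Mathlib

section
/- For every sufficiently small δ > 0 there exist constants C > 0 and N such that for all real s ≥ N and all real h with |h| ≤ s^{2/3−δ}, one has |I_s(s' + h) − I_s(s') e^{−h²/(2s')}| ≤ C s^{−3δ} · I_s(s') e^{−h²/(2s')}; that is, I_s(s'+h) = I_s(s') e^{−h²/(2s')} (1 + O(s^{−3δ})) uniformly for |h| ≤ s^{2/3−δ}. -/
/-- For real `s` and `y > 0`, `I_s(y) = y^((s-1)/2) * exp(-y)`. -/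
noncomputable def Ifun (s y : ℝ) : ℝ := y ^ ((s - 1) / 2) * Real.exp (-y)

/-- Exponentiating a perturbation `x` costs at most the factor `exp |x|` in the linear bound. -/
theorem abs_exp_sub_one_le_abs_mul_exp_abs (x : ℝ) :
    |Real.exp x - 1| ≤ |x| * Real.exp |x| := by
  rcases le_total 0 x with hx | hx
  · rw [abs_of_nonneg hx, abs_of_nonneg (by linarith [Real.add_one_le_exp x])]
    have h₁ := mul_le_mul_of_nonneg_left (Real.add_one_le_exp (-x)) (Real.exp_pos x).le
    rw [← Real.exp_add, add_neg_cancel, Real.exp_zero] at h₁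
    linarith
  · rw [abs_of_nonpos hx, abs_of_nonpos (by linarith [Real.exp_le_one_iff.2 hx])]
    have h₁ := Real.add_one_le_exp x
    have h₂ := Real.one_le_exp (neg_nonneg.2 hx)
    nlinarith

/-- Cubic remainder in the second order expansion of `log (1 + u)`. -/
theorem abs_log_one_add_sub_quadratic_le {u : ℝ} (hu : |u| ≤ 1 / 2) :
    |Real.log (1 + u) - u + u ^ 2 / 2| ≤ 2 * |u| ^ 3 := by
  have h := Real.abs_log_sub_add_sum_range_le (x := -u) (by rw [abs_neg]; linarith) 2
  simp only [Finset.sum_range_succ, Finset.sum_range_zero, abs_neg, sub_neg_eq_add] at h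
  norm_num at h
  calc |Real.log (1 + u) - u + u ^ 2 / 2| = |-u + u ^ 2 / 2 + Real.log (1 + u)| := by
        congr 1; ring
    _ ≤ |u| ^ 3 / (1 - |u|) := h
    _ ≤ 2 * |u| ^ 3 := by
        rw [div_le_iff₀ (by linarith)]
        nlinarith [pow_nonneg (abs_nonneg u) 3]

/-- `Ifun s` near its maximum `k = (s - 1) / 2`, as a Gaussian times an explicit correction. -/
theorem Ifun_add_eq {s k h : ℝ} (hk : (s - 1) / 2 = k) (hk₀ : 0 < k) (hh : 0 < 1 + h / k) :
    Ifun s (k + h) = Ifun s k * Real.exp (-h ^ 2 / (2 * k)) *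
      Real.exp (k * (Real.log (1 + h / k) - h / k + (h / k) ^ 2 / 2)) := by
  have hsplit : k + h = k * (1 + h / k) := by field_simp
  have hpow : (k + h) ^ k = k ^ k * Real.exp (k * Real.log (1 + h / k)) := by
    rw [hsplit, Real.mul_rpow hk₀.le hh.le, Real.rpow_def_of_pos hh, mul_comm k (Real.log _)]
  unfold Ifun
  rw [hk, hpow]
  simp only [mul_assoc, ← Real.exp_add]
  congr 2
  field_simp
  ring

/-- For every sufficiently small `δ > 0` there are `C > 0` and `N` such that for all
`s ≥ N` and all `h` with `|h| ≤ s^(2/3-δ)`,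
`I_s(s'+h) = I_s(s') * exp(-h²/(2s')) * (1 + O(s^(-3δ)))` where `s' = (s-1)/2`. -/
theorem stmt_1 :
    ∃ δ₀ : ℝ, 0 < δ₀ ∧ ∀ δ : ℝ, 0 < δ → δ ≤ δ₀ →
      ∃ C N : ℝ, 0 < C ∧ ∀ s : ℝ, N ≤ s → ∀ h : ℝ, |h| ≤ s ^ (2 / 3 - δ : ℝ) →
        |Ifun s ((s - 1) / 2 + h) -
            Ifun s ((s - 1) / 2) * Real.exp (-h ^ 2 / (2 * ((s - 1) / 2)))| ≤
          C * s ^ (-(3 * δ)) *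
            (Ifun s ((s - 1) / 2) * Real.exp (-h ^ 2 / (2 * ((s - 1) / 2)))) := by
  refine ⟨1, one_pos, fun δ hδ _ => ⟨32 * Real.exp 32, 512, by positivity, ?_⟩⟩
  intro s hs h hh
  obtain ⟨k, hk⟩ : ∃ k, (s - 1) / 2 = k := ⟨_, rfl⟩
  have hs₀ : 0 < s := by linarith
  have hk₀ : 0 < k := by linarith
  have hks : s / 4 ≤ k := by linarith
  have hdecay : s ^ (-(3 * δ)) ≤ 1 :=
    Real.rpow_le_one_of_one_le_of_nonpos (by linarith) (by linarith)
  have hcube : |h| ^ 3 ≤ s ^ 2 * s ^ (-(3 * δ)) := by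
    calc |h| ^ 3 ≤ (s ^ (2 / 3 - δ : ℝ)) ^ 3 := by gcongr
      _ = s ^ 2 * s ^ (-(3 * δ)) := by
        rw [← Real.rpow_natCast, ← Real.rpow_mul hs₀.le, ← Real.rpow_natCast s 2,
          ← Real.rpow_add hs₀]
        congr 1
        push_cast
        ring
  have hsmall : |h| ≤ s / 8 := by
    refine le_of_pow_le_pow_left₀ three_ne_zero (by positivity) ?_
    nlinarith [mul_le_mul_of_nonneg_left hdecay (sq_nonneg s),
      mul_le_mul_of_nonneg_left hs (sq_nonneg s)]
  have hu : |h / k| ≤ 1 / 2 := by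
    rw [abs_div, abs_of_pos hk₀, div_le_iff₀ hk₀]
    linarith
  have hpos : 0 < 1 + h / k := by linarith [(abs_le.1 hu).1]
  rw [hk, Ifun_add_eq hk hk₀ hpos]
  set E := k * (Real.log (1 + h / k) - h / k + (h / k) ^ 2 / 2)
  have hE : |E| ≤ 32 * s ^ (-(3 * δ)) := by
    calc |E| ≤ k * (2 * |h / k| ^ 3) := by
          rw [abs_mul, abs_of_pos hk₀]
          gcongr
          exact abs_log_one_add_sub_quadratic_le hu
      _ = 2 * |h| ^ 3 / k ^ 2 := by
          rw [abs_div, abs_of_pos hk₀]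
          field_simp
      _ ≤ 2 * (s ^ 2 * s ^ (-(3 * δ))) / (s / 4) ^ 2 := by gcongr
      _ = 32 * s ^ (-(3 * δ)) := by
          field_simp
          norm_num
  have hexp : |Real.exp E - 1| ≤ 32 * Real.exp 32 * s ^ (-(3 * δ)) := by
    calc |Real.exp E - 1| ≤ |E| * Real.exp |E| := abs_exp_sub_one_le_abs_mul_exp_abs E
      _ ≤ 32 * s ^ (-(3 * δ)) * Real.exp 32 := by
          gcongr
          linarith
      _ = 32 * Real.exp 32 * s ^ (-(3 * δ)) := by ring
  have hG : 0 ≤ Ifun s k * Real.exp (-h ^ 2 / (2 * k)) := by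
    unfold Ifun
    positivity
  rw [← mul_sub_one, abs_mul, abs_of_nonneg hG, mul_comm]
  gcongr
end

section
/- (Natalini–Palumbo inequality) If a > 1, σ > 1 and x > (σ/(σ−1))·(a−1), then x^{a−1} e^{−x} < Γ(a,x) < σ x^{a−1} e^{−x}, where Γ(a,x) = ∫_x^∞ t^{a−1} e^{−t} dt is the upper incomplete gamma function. -/
open MeasureTheory

/-- The upper incomplete gamma function `Γ(a,x) = ∫_x^∞ t^(a-1) e^(-t) dt`. -/
noncomputable def incGamma (a x : ℝ) : ℝ := ∫ t in Set.Ioi x, t ^ (a - 1) * Real.exp (-t)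

theorem integrableOn_incGamma {a x : ℝ} (ha : 0 < a) (hx : 0 ≤ x) :
    IntegrableOn (fun t : ℝ => t ^ (a - 1) * Real.exp (-t)) (Set.Ioi x) := by
  simpa only [mul_comm] using
    (Real.GammaIntegral_convergent ha).mono_set (Set.Ioi_subset_Ioi hx)

theorem incGamma_pos {a x : ℝ} (ha : 0 < a) (hx : 0 ≤ x) : 0 < incGamma a x := by
  have hpos : ∀ t ∈ Set.Ioi x, 0 < t ^ (a - 1) * Real.exp (-t) := fun t ht =>
    mul_pos (Real.rpow_pos_of_pos (hx.trans_lt ht) _) (Real.exp_pos _)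
  rw [incGamma, setIntegral_pos_iff_support_of_nonneg_ae
    ((ae_restrict_mem measurableSet_Ioi).mono fun t ht => (hpos t ht).le)
    (integrableOn_incGamma ha hx),
    Set.inter_eq_right.2 (show Set.Ioi x ⊆ Function.support _ from fun t ht => (hpos t ht).ne')]
  simp

theorem incGamma_add_one {a x : ℝ} (ha : 0 < a) (hx : 0 < x) :
    incGamma (a + 1) x = x ^ a * Real.exp (-x) + a * incGamma a x := by
  have hderiv : ∀ t ∈ Set.Ici x, HasDerivAt (fun t : ℝ => t ^ a * Real.exp (-t))
      (a * (t ^ (a - 1) * Real.exp (-t)) - t ^ (a + 1 - 1) * Real.exp (-t)) t := fun t ht => by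
    refine ((Real.hasDerivAt_rpow_const (p := a) (Or.inl (hx.trans_le ht).ne')).mul
      (hasDerivAt_neg t).exp).congr_deriv ?_
    rw [add_sub_cancel_right]
    ring
  have hlim := tendsto_rpow_mul_exp_neg_mul_atTop_nhds_zero a 1 one_pos
  simp only [neg_one_mul] at hlim
  have h₁ := (integrableOn_incGamma ha hx.le).const_mul a
  have h₂ := integrableOn_incGamma (add_pos ha one_pos) hx.le
  have key := integral_Ioi_of_hasDerivAt_of_tendsto' hderiv (h₁.sub h₂) hlim
  rw [integral_sub h₁ h₂, integral_const_mul] at key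
  simp only [incGamma]
  linarith

theorem mul_incGamma_le_incGamma_add_one {a x : ℝ} (ha : 0 < a) (hx : 0 ≤ x) :
    x * incGamma a x ≤ incGamma (a + 1) x := by
  rw [incGamma, incGamma, ← integral_const_mul]
  refine setIntegral_mono_on ((integrableOn_incGamma ha hx).const_mul x)
    (integrableOn_incGamma (add_pos ha one_pos) hx) measurableSet_Ioi fun t ht => ?_
  have ht₀ : 0 < t := hx.trans_lt ht
  rw [add_sub_right_comm, Real.rpow_add_one ht₀.ne', mul_comm (t ^ (a - 1)) t, mul_assoc]
  exact mul_le_mul_of_nonneg_right (le_of_lt ht) (by positivity)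

/-- Natalini–Palumbo inequality: if `a > 1`, `σ > 1` and `x > σ/(σ-1)·(a-1)`, then
`x^(a-1) e^(-x) < Γ(a,x) < σ x^(a-1) e^(-x)`. -/
theorem stmt_2 (a σ x : ℝ) (ha : 1 < a) (hσ : 1 < σ)
    (hx : σ / (σ - 1) * (a - 1) < x) :
    x ^ (a - 1) * Real.exp (-x) < incGamma a x ∧
      incGamma a x < σ * (x ^ (a - 1) * Real.exp (-x)) := by
  have hs : 0 < a - 1 := sub_pos.2 ha
  have hσ' : 0 < σ - 1 := sub_pos.2 hσ
  have hx₀ : 0 < x := lt_trans (by positivity) hx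
  have hσx : σ * (a - 1) < x * (σ - 1) := by
    rwa [div_mul_eq_mul_div, div_lt_iff₀ hσ'] at hx
  have hrec := incGamma_add_one hs hx₀
  have hle := mul_incGamma_le_incGamma_add_one hs hx₀.le
  have hpos := incGamma_pos hs hx₀.le
  rw [sub_add_cancel] at hrec hle
  refine ⟨by nlinarith, ?_⟩
  have hG : 0 < incGamma a x := incGamma_pos (by linarith) hx₀.le
  have hbound : (x - (a - 1)) * incGamma a x ≤ x * (x ^ (a - 1) * Real.exp (-x)) := by
    nlinarith [mul_le_mul_of_nonneg_left hle hs.le]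
  have hlt : x * incGamma a x < σ * ((x - (a - 1)) * incGamma a x) := by
    nlinarith [mul_pos (sub_pos.2 hσx) hG]
  refine lt_of_mul_lt_mul_left ?_ hx₀.le
  nlinarith [mul_le_mul_of_nonneg_left hbound (zero_le_one.trans hσ.le)]
end

section
/- There exists K such that for every even integer k ≥ K and every λ : ℕ → ℝ with λ(1) = 1 and |λ(n)| ≤ d(n) for all n ≥ 1, the function f_k(z) = Σ_{n=1}^∞ λ(n) n^{(k−1)/2} e^{2πinz} has no zeros in the region {z ∈ ℍ : Im z > (log 4/(4π)) · k}. -/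
/-- `f_k(z) = Σ_{n≥1} λ(n) n^((k-1)/2) e(nz)`. -/
noncomputable def fk (k : ℕ) (lam : ℕ → ℝ) (z : ℂ) : ℂ :=
  ∑' n : ℕ, (lam (n + 1) : ℂ) * (((n + 1 : ℕ) : ℝ) ^ (((k : ℝ) - 1) / 2) : ℝ) *
    Complex.exp (2 * Real.pi * Complex.I * (n + 1 : ℕ) * z)

/-- A series dominated by `c * (1/4)^n` whose zeroth term has norm `c > 0` does not vanish. -/
theorem tsum_ne_zero_of_norm_le_geometric {f : ℕ → ℂ} {c : ℝ} (hc : 0 < c) (h0 : ‖f 0‖ = c)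
    (hf : ∀ n, ‖f n‖ ≤ c * (1 / 4 : ℝ) ^ n) : ∑' n, f n ≠ 0 := by
  have hg : HasSum (fun n : ℕ => (1 / 4 : ℝ) ^ n) (1 - 1 / 4)⁻¹ :=
    hasSum_geometric_of_lt_one (by norm_num) (by norm_num)
  have hs : Summable f := Summable.of_norm_bounded (hg.summable.mul_left c) hf
  have htail : ‖∑' n, f (n + 1)‖ ≤ c / 4 * (1 - 1 / 4)⁻¹ :=
    tsum_of_norm_bounded (hg.mul_left (c / 4)) fun n => (hf (n + 1)).trans_eq (by ring)
  rw [hs.tsum_eq_zero_add]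
  intro h
  rw [← norm_neg, ← eq_neg_of_add_eq_zero_left h, h0] at htail
  norm_num at htail
  linarith

theorem norm_cexp_two_pi_I_nat_mul (n : ℕ) (z : ℂ) :
    ‖Complex.exp (2 * Real.pi * Complex.I * n * z)‖ = Real.exp (-(2 * Real.pi * n * z.im)) := by
  rw [Complex.norm_exp]
  congr 1
  simp [mul_comm, mul_left_comm]

/-- The power weight `n^((k-1)/2)`, the divisor bound and the exponential decay combine to
geometric decay. -/
theorem succ_mul_rpow_mul_exp_le {k : ℕ} (hk : (5 : ℝ) ≤ k) {y : ℝ}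
    (hy : Real.log 4 / (4 * Real.pi) * k < y) (n : ℕ) :
    ((n + 1 : ℕ) : ℝ) * ((n + 1 : ℕ) : ℝ) ^ (((k : ℝ) - 1) / 2) *
      Real.exp (-(2 * Real.pi * n * y)) ≤ (1 / 4 : ℝ) ^ n := by
  have hlog : Real.log 4 = 2 * Real.log 2 := by
    rw [show (4 : ℝ) = 2 ^ 2 by norm_num, Real.log_pow]; norm_num
  have hy' : Real.log 2 * k ≤ 2 * Real.pi * y := by
    have h := mul_le_mul_of_nonneg_left hy.le (by positivity : 0 ≤ 2 * Real.pi)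
    refine le_trans (le_of_eq ?_) h
    rw [hlog]
    field_simp
    ring
  have hn : ((n + 1 : ℕ) : ℝ) ≤ Real.exp (Real.log 2 * n) := by
    rw [← Real.rpow_def_of_pos two_pos, Real.rpow_natCast]
    exact_mod_cast Nat.lt_two_pow_self
  have hpow : ((n + 1 : ℕ) : ℝ) ^ (((k : ℝ) - 1) / 2) ≤
      Real.exp (Real.log 2 * n * (((k : ℝ) - 1) / 2)) := by
    rw [Real.exp_mul]
    exact Real.rpow_le_rpow (by positivity) hn (by linarith)
  have hr : (1 / 4 : ℝ) ^ n = Real.exp (-(2 * Real.log 2) * n) := by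
    rw [← hlog, mul_comm, Real.exp_nat_mul, Real.exp_neg, Real.exp_log (by norm_num), one_div]
  calc _ ≤ Real.exp (Real.log 2 * n) * Real.exp (Real.log 2 * n * (((k : ℝ) - 1) / 2)) *
        Real.exp (-(Real.log 2 * k * n)) := by
        refine mul_le_mul (mul_le_mul hn hpow (by positivity) (by positivity))
          (Real.exp_le_exp.2 ?_) (by positivity) (by positivity)
        linarith [mul_le_mul_of_nonneg_right hy' (Nat.cast_nonneg (α := ℝ) n)]
    _ ≤ _ := by
        rw [hr, ← Real.exp_add, ← Real.exp_add, Real.exp_le_exp]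
        have h2 : 0 ≤ Real.log 2 * n := mul_nonneg (Real.log_nonneg (by norm_num)) n.cast_nonneg
        nlinarith

/-- There is `K` such that for every even `k ≥ K` and every `λ` with `λ(1) = 1` and
`|λ(n)| ≤ d(n)`, `f_k` has no zeros in `{z : Im z > (log 4/(4π)) k}`. -/
theorem stmt_7 :
    ∃ K : ℝ, ∀ k : ℕ, Even k → K ≤ (k : ℝ) →
      ∀ lam : ℕ → ℝ, lam 1 = 1 → (∀ n : ℕ, 1 ≤ n → |lam n| ≤ (n.divisors.card : ℝ)) →
        ∀ z : ℂ, Real.log 4 / (4 * Real.pi) * k < z.im → fk k lam z ≠ 0 := by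
  refine ⟨5, fun k _ hk lam h1 hlam z hz => ?_⟩
  refine tsum_ne_zero_of_norm_le_geometric (Real.exp_pos (-(2 * Real.pi * z.im))) ?_ fun n => ?_
  · rw [norm_mul, norm_cexp_two_pi_I_nat_mul]
    simp [h1]
  · rw [norm_mul, norm_mul, norm_cexp_two_pi_I_nat_mul, Complex.norm_real, Complex.norm_real,
      Real.norm_eq_abs, Real.norm_of_nonneg (by positivity)]
    have hd : |lam (n + 1)| ≤ ((n + 1 : ℕ) : ℝ) :=
      (hlam _ n.succ_pos).trans (by exact_mod_cast Nat.card_divisors_le_self (n + 1))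
    have hexp : Real.exp (-(2 * Real.pi * (n + 1 : ℕ) * z.im)) =
        Real.exp (-(2 * Real.pi * z.im)) * Real.exp (-(2 * Real.pi * n * z.im)) := by
      rw [← Real.exp_add]
      push_cast
      ring_nf
    calc _ ≤ ((n + 1 : ℕ) : ℝ) * ((n + 1 : ℕ) : ℝ) ^ (((k : ℝ) - 1) / 2) *
          Real.exp (-(2 * Real.pi * (n + 1 : ℕ) * z.im)) := by gcongr
      _ = Real.exp (-(2 * Real.pi * z.im)) * (((n + 1 : ℕ) : ℝ) *
          ((n + 1 : ℕ) : ℝ) ^ (((k : ℝ) - 1) / 2) * Real.exp (-(2 * Real.pi * n * z.im))) := by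
        rw [hexp]
        ring
      _ ≤ _ := by
        gcongr
        exact succ_mul_rpow_mul_exp_le hk hz n
end

section
/- Let U_n denote the n-th Chebyshev polynomial of the second kind, so that U_n(cos θ) = sin((n+1)θ)/sin θ for θ ∈ (0,π). For every integer J ≥ 1 there exists an integer B ≥ 1 (depending only on J) such that for every θ ∈ [0, π] there is an integer b with 1 ≤ b ≤ B such that U_{bj}(cos θ) ≥ 1/10 for all integers j with 1 ≤ j ≤ J. -/
open Polynomial in
/-- Simultaneous recurrence: some multiple `b * θ` returns so close to `2πℤ` that
`U_{bj}(cos θ)` is close to `1` for all `j ≤ J`. -/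
lemma exists_lt_eval_chebyshev_U_of_sin_pos (J : ℕ) {c θ : ℝ} (hc : c < 1)
    (hθ : 0 < Real.sin θ) :
    ∃ b : ℕ, 1 ≤ b ∧ ∀ j ≤ J,
      c < (Chebyshev.U ℝ ((b * j : ℕ) : ℤ)).eval (Real.cos θ) := by
  have hev : ∀ᶠ δ in nhds (0 : ℝ), ∀ j ∈ Finset.range (J + 1),
      c * Real.sin θ < Real.sin (θ + j * δ) := by
    rw [Filter.eventually_all_finset]
    intro j _
    have hcont : ContinuousAt (fun δ : ℝ => Real.sin (θ + j * δ)) 0 := by fun_prop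
    refine hcont.eventually_const_lt ?_
    simpa using mul_lt_of_lt_one_left hθ hc
  obtain ⟨ε, hε, hball⟩ := Metric.eventually_nhds_iff.mp hev
  have hpi := Real.pi_pos
  obtain ⟨n, hn⟩ := exists_nat_gt (2 * Real.pi / ε)
  have hn0 : (0 : ℝ) < n := lt_trans (by positivity) hn
  obtain ⟨b, hb, -, hbn⟩ := Real.exists_nat_abs_mul_sub_round_le (θ / (2 * Real.pi))
    (Nat.cast_pos.mp hn0)
  set m : ℤ := round ((b : ℝ) * (θ / (2 * Real.pi)))
  refine ⟨b, hb, fun j hj => ?_⟩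
  have hδ : b * θ - 2 * Real.pi * m = 2 * Real.pi * (b * (θ / (2 * Real.pi)) - m) := by
    field_simp
  have hsmall : dist (b * θ - 2 * Real.pi * m) 0 < ε := by
    rw [dist_zero_right, Real.norm_eq_abs, hδ, abs_mul, abs_of_pos (by positivity)]
    calc 2 * Real.pi * |b * (θ / (2 * Real.pi)) - m| ≤ 2 * Real.pi * (1 / (n + 1)) := by gcongr
      _ ≤ 2 * Real.pi * (1 / n) := by gcongr; linarith
      _ < ε := by
        rw [mul_one_div]
        exact (div_lt_comm₀ hε hn0).mp hn
  have hlt := hball hsmall j (Finset.mem_range.mpr (by omega))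
  have hsin : Real.sin (θ + j * (b * θ - 2 * Real.pi * m)) =
      Real.sin ((((b * j : ℕ) : ℤ) + 1) * θ) := by
    rw [← Real.sin_sub_int_mul_two_pi ((((b * j : ℕ) : ℤ) + 1) * θ) (j * m)]
    congr 1
    push_cast
    ring
  rw [hsin, ← Chebyshev.U_real_cos] at hlt
  exact lt_of_mul_lt_mul_right hlt hθ.le

open Polynomial in
lemma one_le_eval_chebyshev_U_two_mul_of_sin_eq_zero (j : ℕ) {θ : ℝ} (hθ : Real.sin θ = 0) :
    1 ≤ (Chebyshev.U ℝ ((2 * j : ℕ) : ℤ)).eval (Real.cos θ) := by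
  rcases Real.sin_eq_zero_iff_cos_eq.mp hθ with h | h
  · rw [h, Chebyshev.U_eval_one]
    push_cast
    linarith [(Nat.cast_nonneg j : (0 : ℝ) ≤ j)]
  · rw [h, Chebyshev.U_eval_neg_one, Int.negOnePow_even _ (by simp)]
    push_cast
    linarith [(Nat.cast_nonneg j : (0 : ℝ) ≤ j)]

/-- For every `J ≥ 1` there is `B ≥ 1` (depending only on `J`) such that for every
`θ ∈ [0, π]` there is `1 ≤ b ≤ B` with `U_{bj}(cos θ) ≥ 1/10` for all `1 ≤ j ≤ J`,
where `U_n` is the `n`-th Chebyshev polynomial of the second kind (so that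
`U_n(cos θ) sin θ = sin ((n+1)θ)`). -/
theorem stmt_8 :
    ∀ J : ℕ, 1 ≤ J → ∃ B : ℕ, 1 ≤ B ∧
      ∀ θ ∈ Set.Icc (0 : ℝ) Real.pi, ∃ b : ℕ, 1 ≤ b ∧ b ≤ B ∧
        ∀ j : ℕ, 1 ≤ j → j ≤ J →
          (1 / 10 : ℝ) ≤ (Polynomial.Chebyshev.U ℝ ((b * j : ℕ) : ℤ)).eval (Real.cos θ) := by
  intro J _
  let V (b : ℕ) : Set ℝ := {θ | ∀ j ∈ Finset.range (J + 1),
    (1 / 10 : ℝ) < (Polynomial.Chebyshev.U ℝ ((b * j : ℕ) : ℤ)).eval (Real.cos θ)}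
  have hopen (b : ℕ) : IsOpen (V b) := by
    simp only [V, Set.ofPred_forall]
    refine isOpen_biInter_finset fun j _ => isOpen_lt continuous_const ?_
    exact (Polynomial.continuous _).comp Real.continuous_cos
  have hcover : Set.Icc 0 Real.pi ⊆ ⋃ b : ℕ, V (b + 1) := by
    intro θ hθ
    rw [Set.mem_iUnion]
    rcases (Real.sin_nonneg_of_mem_Icc hθ).eq_or_lt with h | h
    · refine ⟨1, fun j _ => ?_⟩
      exact lt_of_lt_of_le (by norm_num)
        (one_le_eval_chebyshev_U_two_mul_of_sin_eq_zero j h.symm)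
    · obtain ⟨b, hb, hbJ⟩ := exists_lt_eval_chebyshev_U_of_sin_pos J
        (c := 1 / 10) (by norm_num) h
      obtain ⟨b, rfl⟩ := Nat.exists_eq_add_of_le' hb
      exact ⟨b, fun j hj => hbJ j (Nat.lt_succ_iff.mp (Finset.mem_range.mp hj))⟩
  obtain ⟨t, ht⟩ := isCompact_Icc.elim_finite_subcover _ (fun b => hopen (b + 1)) hcover
  refine ⟨t.sup id + 1, by omega, fun θ hθ => ?_⟩
  obtain ⟨b, hbt, hb⟩ := Set.mem_iUnion₂.mp (ht hθ)
  refine ⟨b + 1, by omega, Nat.succ_le_succ (Finset.le_sup (f := id) hbt), fun j _ hj => ?_⟩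
  exact (hb j (Finset.mem_range.mpr (by omega))).le
end

section
/- There exist constants C > 0 and K such that for every even integer k ≥ K and every Hecke-multiplicative λ, there are at least C log k distinct real numbers y ≥ √(k log k) with f_k(1/2 + iy) = 0; that is, f_k has at least C log k zeros on the vertical line segment δ₂ = {Re z = 1/2, Im z ≥ √(k log k)}. -/
/-- `λ : ℕ → ℝ` is Hecke-multiplicative: `λ(1) = 1`, `λ` is multiplicative on coprime
arguments, satisfies the Hecke recursion at prime powers, and Deligne's bound
`|λ(p)| ≤ 2` at primes. -/
def HeckeMult (lam : ℕ → ℝ) : Prop :=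
  lam 1 = 1 ∧
  (∀ m n : ℕ, Nat.Coprime m n → lam (m * n) = lam m * lam n) ∧
  (∀ p n : ℕ, p.Prime → 1 ≤ n → lam p * lam (p ^ n) = lam (p ^ (n + 1)) + lam (p ^ (n - 1))) ∧
  (∀ p : ℕ, p.Prime → |lam p| ≤ 2)

namespace HeckeMult

variable {lam : ℕ → ℝ}

lemma abs_prime_pow_le (h : HeckeMult lam) {p : ℕ} (hp : p.Prime) (n : ℕ) :
    |lam (p ^ n)| ≤ ((p : ℝ) ^ 2) ^ n := by
  obtain ⟨h1, -, hrec, hdel⟩ := h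
  have hq : (4 : ℝ) ≤ (p : ℝ) ^ 2 := by
    have : (2 : ℝ) ≤ p := by exact_mod_cast hp.two_le
    nlinarith
  induction n using Nat.twoStepInduction with
  | zero => simp [h1]
  | one => simpa using (hdel p hp).trans (by linarith)
  | more n ih₀ ih₁ =>
    have hr := hrec p (n + 1) hp (by omega)
    simp only [Nat.add_sub_cancel] at hr
    have hmul : |lam p * lam (p ^ (n + 1))| ≤ 2 * ((p : ℝ) ^ 2) ^ (n + 1) := by
      rw [abs_mul]
      exact mul_le_mul (hdel p hp) ih₁ (abs_nonneg _) zero_le_two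
    have hpos : 0 ≤ ((p : ℝ) ^ 2) ^ n := by positivity
    calc |lam (p ^ (n + 2))| = |lam p * lam (p ^ (n + 1)) - lam (p ^ n)| := by
          rw [hr]; congr 1; ring
      _ ≤ |lam p * lam (p ^ (n + 1))| + |lam (p ^ n)| := abs_sub _ _
      _ ≤ 2 * (((p : ℝ) ^ 2) ^ n * (p : ℝ) ^ 2) + ((p : ℝ) ^ 2) ^ n := by
          rw [← pow_succ]; exact add_le_add hmul ih₀
      _ ≤ ((p : ℝ) ^ 2) ^ n * ((p : ℝ) ^ 2 * (p : ℝ) ^ 2) := by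
          have : 2 * (p : ℝ) ^ 2 + 1 ≤ (p : ℝ) ^ 2 * (p : ℝ) ^ 2 := by nlinarith
          linarith [mul_le_mul_of_nonneg_left this hpos]
      _ = ((p : ℝ) ^ 2) ^ (n + 2) := by ring

lemma abs_le_sq (h : HeckeMult lam) (n : ℕ) (hn : n ≠ 0) : |lam n| ≤ (n : ℝ) ^ 2 := by
  induction n using Nat.recOnPosPrimePosCoprime with
  | prime_pow p n hp _ =>
    refine (h.abs_prime_pow_le hp n).trans (le_of_eq ?_)
    push_cast
    ring
  | zero => exact absurd rfl hn
  | one => simp [h.1]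
  | coprime a b ha hb hab iha ihb =>
    rw [h.2.1 a b hab, abs_mul]
    push_cast
    rw [mul_pow]
    exact mul_le_mul (iha (by omega)) (ihb (by omega)) (abs_nonneg _) (by positivity)

lemma abs_le_exp (h : HeckeMult lam) (n : ℕ) (hn : n ≠ 0) : |lam n| ≤ Real.exp (2 * n) := by
  refine (h.abs_le_sq n hn).trans ?_
  have hexp : (n : ℝ) ≤ Real.exp n := by linarith [Real.add_one_le_exp (n : ℝ)]
  calc (n : ℝ) ^ 2 ≤ Real.exp n ^ 2 := by gcongr
    _ = Real.exp (2 * n) := by rw [← Real.exp_nat_mul]; norm_num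

lemma prime_pow_quadratic (h : HeckeMult lam) {p : ℕ} (hp : p.Prime) (n : ℕ) :
    lam (p ^ (n + 1)) ^ 2 - lam p * lam (p ^ (n + 1)) * lam (p ^ n) + lam (p ^ n) ^ 2 = 1 := by
  obtain ⟨h1, -, hrec, -⟩ := h
  induction n with
  | zero => simp [h1]; ring
  | succ n ih =>
    have hr := hrec p (n + 1) hp (by omega)
    simp only [Nat.add_sub_cancel] at hr
    have hr' : lam (p ^ (n + 1 + 1)) = lam p * lam (p ^ (n + 1)) - lam (p ^ n) := by linarith
    rw [hr']
    linear_combination ih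

lemma exists_half_le_abs_prime_pow (h : HeckeMult lam) {p : ℕ} (hp : p.Prime) (n : ℕ) :
    1 / 2 ≤ |lam (p ^ n)| ∨ 1 / 2 ≤ |lam (p ^ (n + 1))| := by
  by_contra! hlt
  obtain ⟨hu, hv⟩ := hlt
  have hq := h.prime_pow_quadratic hp n
  have hcross : |lam p * lam (p ^ (n + 1)) * lam (p ^ n)| ≤ 2 * (1 / 2) * (1 / 2) := by
    rw [abs_mul, abs_mul]
    exact mul_le_mul (mul_le_mul (h.2.2.2 p hp) hv.le (abs_nonneg _) zero_le_two) hu.le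
      (abs_nonneg _) (by norm_num)
  have hu2 : lam (p ^ n) ^ 2 < (1 / 2) ^ 2 := sq_lt_sq' (abs_lt.1 hu).1 (abs_lt.1 hu).2
  have hv2 : lam (p ^ (n + 1)) ^ 2 < (1 / 2) ^ 2 := sq_lt_sq' (abs_lt.1 hv).1 (abs_lt.1 hv).2
  linarith [neg_abs_le (lam p * lam (p ^ (n + 1)) * lam (p ^ n))]

lemma exists_le_two_pow (h : HeckeMult lam) :
    ∃ j, 1 ≤ j ∧ j ≤ 4 ∧ 1 / 20 ≤ lam (2 ^ j) := by
  obtain ⟨h1, -, hrec, hdel⟩ := h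
  have hp := Nat.prime_two
  have e2 : lam (2 ^ 2) = lam 2 ^ 2 - 1 := by
    have := hrec 2 1 hp le_rfl
    norm_num [h1] at this ⊢
    linarith
  have e3 : lam (2 ^ 3) = lam 2 * (lam 2 ^ 2 - 2) := by
    have := hrec 2 2 hp (by norm_num)
    rw [e2] at this
    norm_num at this ⊢
    linarith
  have e4 : lam (2 ^ 4) = lam 2 ^ 4 - 3 * lam 2 ^ 2 + 1 := by
    have := hrec 2 3 hp (by norm_num)
    rw [e3] at this
    norm_num at this ⊢ e2
    rw [e2] at this
    linarith
  by_cases c1 : 1 / 10 ≤ lam 2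
  · exact ⟨1, by norm_num, by norm_num, by rw [pow_one]; linarith⟩
  by_cases c2 : 3 / 2 ≤ lam 2 ^ 2
  · exact ⟨2, by norm_num, by norm_num, by rw [e2]; linarith⟩
  by_cases c3 : lam 2 ≤ -(1 / 10)
  · refine ⟨3, by norm_num, by norm_num, ?_⟩
    rw [e3]
    nlinarith
  · refine ⟨4, by norm_num, by norm_num, ?_⟩
    rw [e4]
    push Not at c1 c2 c3
    have : lam 2 ^ 2 ≤ 1 / 100 := by nlinarith
    nlinarith [sq_nonneg (lam 2 ^ 2)]

/-- Each interval `[81 ^ i, 81 ^ (i + 1))` contains a pair `3 ^ m < 2 ^ j * 3 ^ m` at which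
`(-1) ^ n * λ n` takes opposite signs. -/
lemma exists_sign_change (h : HeckeMult lam) (i : ℕ) :
    ∃ a b : ℕ, 81 ^ i ≤ a ∧ a < b ∧ b < 81 ^ (i + 1) ∧ 1 / 40 ≤ |(-1) ^ a * lam a| ∧
      1 / 40 ≤ |(-1) ^ b * lam b| ∧ ((-1) ^ a * lam a) * ((-1) ^ b * lam b) ≤ 0 := by
  obtain ⟨j, hj1, hj4, hj⟩ := h.exists_le_two_pow
  obtain ⟨m, hm, hm', hlam⟩ : ∃ m, 4 * i ≤ m ∧ m ≤ 4 * i + 1 ∧ 1 / 2 ≤ |lam (3 ^ m)| := by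
    rcases h.exists_half_le_abs_prime_pow Nat.prime_three (4 * i) with hu | hu
    · exact ⟨_, le_rfl, by omega, hu⟩
    · exact ⟨_, by omega, le_rfl, hu⟩
  have hodd : Odd (3 ^ m) := Odd.pow (by decide)
  have heven : Even (2 ^ j * 3 ^ m) := (even_two.pow_of_ne_zero (by omega)).mul_right _
  have hmul : lam (2 ^ j * 3 ^ m) = lam (2 ^ j) * lam (3 ^ m) :=
    h.2.1 _ _ (Nat.Coprime.pow _ _ (by norm_num))
  have h81 : 81 ^ i = 3 ^ (4 * i) := by rw [pow_mul]; norm_num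
  have h3 : 0 < 3 ^ m := by positivity
  refine ⟨3 ^ m, 2 ^ j * 3 ^ m, ?_, ?_, ?_, ?_, ?_, ?_⟩
  · rw [h81]; exact Nat.pow_le_pow_right (by norm_num) hm
  · have : 2 ^ 1 ≤ 2 ^ j := Nat.pow_le_pow_right (by norm_num) hj1
    nlinarith
  · have h2 : 2 ^ j ≤ 2 ^ 4 := Nat.pow_le_pow_right (by norm_num) hj4
    have h3' : 3 ^ m ≤ 3 ^ (4 * i + 1) := Nat.pow_le_pow_right (by norm_num) hm'
    calc 2 ^ j * 3 ^ m ≤ 2 ^ 4 * 3 ^ (4 * i + 1) := Nat.mul_le_mul h2 h3'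
      _ = 48 * 81 ^ i := by rw [h81]; ring
      _ < 81 ^ (i + 1) := by
          have : 0 < 81 ^ i := by positivity
          rw [pow_succ]
          omega
  · rw [hodd.neg_one_pow, abs_mul]; norm_num; linarith
  · rw [heven.neg_one_pow, hmul, one_mul, abs_mul, abs_of_nonneg (by linarith : 0 ≤ lam (2 ^ j))]
    nlinarith
  · rw [heven.neg_one_pow, hodd.neg_one_pow, hmul]
    nlinarith [sq_nonneg (lam (3 ^ m))]

end HeckeMult

/-- The `n`-th term of the Fourier expansion of weight `2 * κ + 1` at `1 / 2 + i y`. -/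
noncomputable def midlineTerm (κ : ℝ) (lam : ℕ → ℝ) (y : ℝ) (n : ℕ) : ℝ :=
  (-1) ^ n * lam n * ((n : ℝ) ^ κ * Real.exp (-(2 * Real.pi * n * y)))

/-- The Fourier series of weight `2 * κ + 1` at `1 / 2 + i y`, as a real function of `y`. -/
noncomputable def midlineSeries (κ : ℝ) (lam : ℕ → ℝ) (y : ℝ) : ℝ :=
  ∑' n : ℕ, midlineTerm κ lam y (n + 1)

lemma fk_half_add_mul_I (k : ℕ) (lam : ℕ → ℝ) (y : ℝ) :
    fk k lam ((1 / 2 : ℝ) + (y : ℝ) * Complex.I) =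
      (midlineSeries (((k : ℝ) - 1) / 2) lam y : ℂ) := by
  rw [fk, midlineSeries, Complex.ofReal_tsum]
  refine tsum_congr fun n => ?_
  have hexp : Complex.exp (2 * Real.pi * Complex.I * (n + 1 : ℕ) *
      ((1 / 2 : ℝ) + (y : ℝ) * Complex.I)) =
      (-1) ^ (n + 1) * (Real.exp (-(2 * Real.pi * (n + 1 : ℕ) * y)) : ℂ) := by
    rw [← Complex.exp_pi_mul_I, ← Complex.exp_nat_mul, Complex.ofReal_exp, ← Complex.exp_add]
    congr 1
    push_cast
    linear_combination (2 * Real.pi * (n + 1) * y : ℂ) * Complex.I_sq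
  rw [hexp, midlineTerm]
  push_cast
  ring

lemma log_le_sub_one_sub {x : ℝ} (hx : 0 < x) :
    Real.log x ≤ x - 1 - (x - 1) ^ 2 / (2 * (x + 1)) := by
  have hs : 0 < √x := Real.sqrt_pos.2 hx
  have hsq : √x ^ 2 = x := Real.sq_sqrt hx.le
  have hlog : Real.log x ≤ 2 * (√x - 1) := by
    have := Real.log_le_sub_one_of_pos hs
    rw [Real.log_sqrt hx.le] at this
    linarith
  have hdiv : (x - 1) ^ 2 / (2 * (x + 1)) ≤ (√x - 1) ^ 2 := by
    rw [div_le_iff₀ (by positivity)]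
    have : (√x - 1) ^ 2 * (2 * (x + 1)) - (x - 1) ^ 2 = (√x - 1) ^ 4 := by
      rw [← hsq, Real.sqrt_sq hs.le]; ring
    nlinarith [sq_nonneg ((√x - 1) ^ 2)]
  nlinarith

lemma mul_add_le_sq_mul_sq_sub {n l : ℕ} (hl : 0 < l) (hne : n ≠ l) :
    (n : ℝ) * (n + l) ≤ 6 * l ^ 2 * ((n : ℝ) - l) ^ 2 := by
  have hl' : (1 : ℝ) ≤ l := by exact_mod_cast hl
  have hn : (0 : ℝ) ≤ n := n.cast_nonneg
  have hd : 1 ≤ |(n : ℝ) - l| := by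
    have : 1 ≤ |(n : ℤ) - l| := Int.one_le_abs (sub_ne_zero.2 (by exact_mod_cast hne))
    exact_mod_cast this
  have hle : (n : ℝ) ≤ l + |(n : ℝ) - l| := by linarith [le_abs_self ((n : ℝ) - l)]
  have hprod : (l : ℝ) + |(n : ℝ) - l| ≤ 2 * (l * |(n : ℝ) - l|) := by nlinarith
  have hlp : (l : ℝ) ≤ l * |(n : ℝ) - l| := by nlinarith
  calc (n : ℝ) * (n + l) ≤ (2 * (l * |(n : ℝ) - l|)) * (3 * (l * |(n : ℝ) - l|)) :=
        mul_le_mul (by linarith) (by linarith) (by positivity) (by positivity)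
    _ = 6 * l ^ 2 * |(n : ℝ) - l| ^ 2 := by ring
    _ = 6 * l ^ 2 * ((n : ℝ) - l) ^ 2 := by rw [sq_abs]

lemma rpow_mul_exp_le {κ : ℝ} {n l : ℕ} (hn : 0 < n) (hl : 0 < l) (hne : n ≠ l)
    (hκ : 120 * (l : ℝ) ^ 3 ≤ κ) :
    (n : ℝ) ^ κ * Real.exp (-(κ * n / l)) ≤
      (l : ℝ) ^ κ * Real.exp (-κ) * Real.exp (-(10 * n)) := by
  have hn' : (0 : ℝ) < n := by exact_mod_cast hn
  have hl' : (0 : ℝ) < l := by exact_mod_cast hl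
  have hκ0 : 0 ≤ κ := le_trans (by positivity) hκ
  rw [Real.rpow_def_of_pos hn', Real.rpow_def_of_pos hl', ← Real.exp_add, ← Real.exp_add,
    ← Real.exp_add, Real.exp_le_exp]
  have hlog := log_le_sub_one_sub (div_pos hn' hl')
  rw [Real.log_div hn'.ne' hl'.ne'] at hlog
  have hgap : (n : ℝ) / (12 * l ^ 3) ≤ ((n : ℝ) / l - 1) ^ 2 / (2 * ((n : ℝ) / l + 1)) := by
    have : ((n : ℝ) / l - 1) ^ 2 / (2 * ((n : ℝ) / l + 1)) =
        ((n : ℝ) - l) ^ 2 / (2 * l * (n + l)) := by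
      field_simp
    rw [this, div_le_div_iff₀ (by positivity) (by positivity)]
    nlinarith [mul_le_mul_of_nonneg_left (mul_add_le_sq_mul_sq_sub hl hne) hl'.le]
  have hten : 10 * (n : ℝ) ≤ κ * (n / (12 * l ^ 3)) := by
    rw [mul_div_assoc', le_div_iff₀ (by positivity)]
    nlinarith
  have hmul : κ * (Real.log n - Real.log l) ≤ κ * (n / l - 1 - n / (12 * l ^ 3)) :=
    mul_le_mul_of_nonneg_left (by linarith) hκ0
  have : κ * n / l = κ * (n / l) := mul_div_assoc _ _ _
  rw [this]
  nlinarith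

lemma abs_midlineTerm_le {κ : ℝ} {lam : ℕ → ℝ} (h : HeckeMult lam) {n l : ℕ} (hn : 0 < n)
    (hl : 0 < l) (hne : n ≠ l) (hκ : 120 * (l : ℝ) ^ 3 ≤ κ) {y : ℝ}
    (hy : κ / (2 * Real.pi * l) ≤ y) :
    |midlineTerm κ lam y n| ≤ (l : ℝ) ^ κ * Real.exp (-κ) * Real.exp (-8) ^ n := by
  have hl' : (0 : ℝ) < l := by exact_mod_cast hl
  have hexp : Real.exp (-(2 * Real.pi * n * y)) ≤ Real.exp (-(κ * n / l)) := by
    rw [Real.exp_le_exp, neg_le_neg_iff]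
    rw [div_le_iff₀ (by positivity)] at hy
    rw [div_le_iff₀ hl']
    nlinarith [mul_le_mul_of_nonneg_right hy (n.cast_nonneg : (0 : ℝ) ≤ n)]
  rw [midlineTerm, abs_mul, abs_mul, abs_pow, abs_neg, abs_one, one_pow, one_mul,
    abs_of_nonneg (by positivity : 0 ≤ (n : ℝ) ^ κ * Real.exp (-(2 * Real.pi * n * y)))]
  calc |lam n| * ((n : ℝ) ^ κ * Real.exp (-(2 * Real.pi * n * y)))
      ≤ Real.exp (2 * n) * ((l : ℝ) ^ κ * Real.exp (-κ) * Real.exp (-(10 * n))) := by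
        refine mul_le_mul (h.abs_le_exp n hn.ne') (le_trans ?_ (rpow_mul_exp_le hn hl hne hκ))
          (by positivity) (by positivity)
        gcongr
    _ = (l : ℝ) ^ κ * Real.exp (-κ) * Real.exp (-8) ^ n := by
        rw [← Real.exp_nat_mul, mul_left_comm, ← Real.exp_add]
        ring_nf

lemma exp_neg_eight_lt : Real.exp (-8) < 1 / 256 := by
  rw [Real.exp_neg, one_div]
  refine inv_strictAnti₀ (by norm_num) ?_
  calc (256 : ℝ) = 2 ^ 8 := by norm_num
    _ < Real.exp 1 ^ 8 := by gcongr; linarith [Real.exp_one_gt_d9]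
    _ = Real.exp 8 := by rw [← Real.exp_nat_mul]; norm_num

lemma hasSum_exp_neg_eight_pow_succ :
    HasSum (fun n : ℕ => Real.exp (-8) ^ (n + 1)) (Real.exp (-8) / (1 - Real.exp (-8))) := by
  have := (hasSum_geometric_of_lt_one (Real.exp_pos (-8)).le
    (exp_neg_eight_lt.trans (by norm_num))).mul_left (Real.exp (-8))
  simpa only [pow_succ', div_eq_mul_inv] using this

lemma norm_midlineTerm_succ_le {κ : ℝ} {lam : ℕ → ℝ} (h : HeckeMult lam) {l : ℕ} (hl : 0 < l)
    (hκ : 120 * (l : ℝ) ^ 3 ≤ κ) {y : ℝ} (hy : κ / (2 * Real.pi * l) ≤ y) (n : ℕ) :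
    ‖midlineTerm κ lam y (n + 1)‖ ≤ (l : ℝ) ^ κ * Real.exp (-κ) * Real.exp (-8) ^ (n + 1) +
      if n + 1 = l then |lam l| * (l : ℝ) ^ κ else 0 := by
  rw [Real.norm_eq_abs]
  split_ifs with hnl
  · have hy0 : 0 ≤ y := le_trans (div_nonneg (le_trans (by positivity) hκ) (by positivity)) hy
    rw [hnl, midlineTerm, abs_mul, abs_mul, abs_pow, abs_neg, abs_one, one_pow, one_mul,
      abs_of_nonneg (by positivity : 0 ≤ (l : ℝ) ^ κ * Real.exp (-(2 * Real.pi * l * y)))]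
    have hexp : Real.exp (-(2 * Real.pi * l * y)) ≤ 1 := Real.exp_le_one_iff.2
      (neg_nonpos.2 (by positivity))
    have : |lam l| * ((l : ℝ) ^ κ * Real.exp (-(2 * Real.pi * l * y))) ≤
        |lam l| * ((l : ℝ) ^ κ * 1) := by gcongr
    have hpos : 0 ≤ (l : ℝ) ^ κ * Real.exp (-κ) * Real.exp (-8) ^ l := by positivity
    linarith
  · rw [add_zero]
    exact abs_midlineTerm_le h n.succ_pos hl hnl hκ hy

lemma summable_midline_bound (A B : ℝ) (l : ℕ) :
    Summable fun n : ℕ => A * Real.exp (-8) ^ (n + 1) + if n + 1 = l then B else 0 := by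
  refine (hasSum_exp_neg_eight_pow_succ.summable.mul_left A).add ?_
  refine summable_of_ne_finset_zero (s := Finset.range l) fun n hn => if_neg ?_
  rintro rfl
  exact hn (Finset.mem_range.2 n.lt_succ_self)

lemma continuousOn_midlineSeries {κ : ℝ} {lam : ℕ → ℝ} (h : HeckeMult lam) {l : ℕ} (hl : 0 < l)
    (hκ : 120 * (l : ℝ) ^ 3 ≤ κ) :
    ContinuousOn (midlineSeries κ lam) (Set.Ici (κ / (2 * Real.pi * l))) := by
  refine continuousOn_tsum (fun n => ?_)
    (summable_midline_bound ((l : ℝ) ^ κ * Real.exp (-κ)) (|lam l| * (l : ℝ) ^ κ) l)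
    (fun n y hy => norm_midlineTerm_succ_le h hl hκ hy n)
  unfold midlineTerm
  fun_prop

lemma abs_midlineSeries_sub_lt {κ : ℝ} {lam : ℕ → ℝ} (h : HeckeMult lam) {l : ℕ} (hl : 0 < l)
    (hκ : 120 * (l : ℝ) ^ 3 ≤ κ) :
    |midlineSeries κ lam (κ / (2 * Real.pi * l)) -
      (-1) ^ l * lam l * ((l : ℝ) ^ κ * Real.exp (-κ))| <
      1 / 40 * ((l : ℝ) ^ κ * Real.exp (-κ)) := by
  have hl' : (0 : ℝ) < l := by exact_mod_cast hl
  set y := κ / (2 * Real.pi * l) with hy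
  set A := (l : ℝ) ^ κ * Real.exp (-κ) with hA
  have hA0 : 0 < A := by positivity
  have hsum : Summable fun n => midlineTerm κ lam y (n + 1) :=
    Summable.of_norm_bounded (summable_midline_bound _ _ l)
      (fun n => norm_midlineTerm_succ_le h hl hκ le_rfl n)
  have hmain : midlineTerm κ lam y (l - 1 + 1) = (-1) ^ l * lam l * A := by
    rw [Nat.sub_add_cancel hl, midlineTerm, hA, hy]
    congr 4
    have := Real.pi_pos
    field_simp
  rw [midlineSeries, hsum.tsum_eq_add_tsum_ite (l - 1), hmain, add_sub_cancel_left]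
  have hbound := tsum_of_norm_bounded (hasSum_exp_neg_eight_pow_succ.mul_left A)
    (f := fun n => if n = l - 1 then 0 else midlineTerm κ lam y (n + 1)) fun n => by
      split_ifs with hn
      · rw [norm_zero]; positivity
      · exact abs_midlineTerm_le h n.succ_pos hl (by omega) hκ le_rfl
  rw [Real.norm_eq_abs] at hbound
  refine hbound.trans_lt ?_
  rw [mul_comm]
  refine mul_lt_mul_of_pos_right ?_ hA0
  have := exp_neg_eight_lt
  rw [div_lt_iff₀ (by linarith)]
  linarith

lemma mul_nonpos_of_abs_sub_lt {F G u v A B c : ℝ} (hc : 0 < c) (hA : 0 < A)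
    (hB : 0 < B) (hF : |F - u * A| < c * A) (hG : |G - v * B| < c * B) (hu : c ≤ |u|) (hv : c ≤ |v|)
    (huv : u * v ≤ 0) : F * G ≤ 0 := by
  rw [abs_lt] at hF hG
  rcases le_total 0 u with h0 | h0 <;> rcases le_total 0 v with h1 | h1
  · rw [abs_of_nonneg h0] at hu
    rw [abs_of_nonneg h1] at hv
    exact absurd huv (mul_pos (hc.trans_le hu) (hc.trans_le hv)).not_ge
  · rw [abs_of_nonneg h0] at hu
    rw [abs_of_nonpos h1] at hv
    exact mul_nonpos_of_nonneg_of_nonpos (by nlinarith) (by nlinarith)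
  · rw [abs_of_nonpos h0] at hu
    rw [abs_of_nonneg h1] at hv
    exact mul_nonpos_of_nonpos_of_nonneg (by nlinarith) (by nlinarith)
  · rw [abs_of_nonpos h0] at hu
    rw [abs_of_nonpos h1] at hv
    exact absurd huv (mul_pos_of_neg_of_neg (by linarith) (by linarith)).not_ge

lemma exists_midlineSeries_eq_zero {κ : ℝ} {lam : ℕ → ℝ} (h : HeckeMult lam) {a b : ℕ}
    (ha : 0 < a) (hab : a < b) (hκ : 120 * (b : ℝ) ^ 3 ≤ κ)
    (hua : 1 / 40 ≤ |(-1) ^ a * lam a|) (hub : 1 / 40 ≤ |(-1) ^ b * lam b|)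
    (hsign : ((-1) ^ a * lam a) * ((-1) ^ b * lam b) ≤ 0) :
    ∃ y ∈ Set.Icc (κ / (2 * Real.pi * b)) (κ / (2 * Real.pi * a)),
      midlineSeries κ lam y = 0 := by
  have ha' : (0 : ℝ) < a := by exact_mod_cast ha
  have hab' : (a : ℝ) ≤ b := by exact_mod_cast hab.le
  have hb := ha.trans hab
  have hb' : (0 : ℝ) < b := by exact_mod_cast hb
  have hκ0 : 0 ≤ κ := le_trans (by positivity) hκ
  have hκa : 120 * (a : ℝ) ^ 3 ≤ κ := le_trans (by gcongr) hκ
  have hle : κ / (2 * Real.pi * b) ≤ κ / (2 * Real.pi * a) := by gcongr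
  have hprod := mul_nonpos_of_abs_sub_lt (by norm_num) (by positivity) (by positivity)
    (abs_midlineSeries_sub_lt h ha hκa) (abs_midlineSeries_sub_lt h hb hκ) hua hub hsign
  have hcont : ContinuousOn (midlineSeries κ lam)
      (Set.uIcc (κ / (2 * Real.pi * b)) (κ / (2 * Real.pi * a))) := by
    rw [Set.uIcc_of_le hle]
    exact (continuousOn_midlineSeries h hb hκ).mono Set.Icc_subset_Ici_self
  have hmem : (0 : ℝ) ∈ Set.uIcc (midlineSeries κ lam (κ / (2 * Real.pi * b)))
      (midlineSeries κ lam (κ / (2 * Real.pi * a))) := by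
    rw [Set.mem_uIcc]
    rcases mul_nonpos_iff.1 hprod with hs | hs
    · exact Or.inl ⟨hs.2, hs.1⟩
    · exact Or.inr ⟨hs.1, hs.2⟩
  obtain ⟨y, hy, h0⟩ := intermediate_value_uIcc hcont hmem
  rw [Set.uIcc_of_le hle] at hy
  exact ⟨y, hy, h0⟩

lemma exists_finset_midlineSeries_eq_zero {κ : ℝ} {lam : ℕ → ℝ} (h : HeckeMult lam) (N : ℕ)
    (hκ : 120 * ((81 : ℝ) ^ N) ^ 3 ≤ κ) :
    ∃ S : Finset ℝ, S.card = N ∧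
      ∀ y ∈ S, κ / (2 * Real.pi * 81 ^ N) ≤ y ∧ midlineSeries κ lam y = 0 := by
  have hκ0 : 0 < κ := lt_of_lt_of_le (by positivity) hκ
  choose a b hla hab hbl hua hub hsign using h.exists_sign_change
  have hapos : ∀ i, 0 < a i := fun i => lt_of_lt_of_le (by positivity) (hla i)
  have hbpos : ∀ i, (0 : ℝ) < b i := fun i => by exact_mod_cast (hapos i).trans (hab i)
  have hbN : ∀ i < N, (b i : ℝ) ≤ 81 ^ N := fun i hi => by
    exact_mod_cast (hbl i).le.trans (Nat.pow_le_pow_right (by norm_num) hi)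
  have hzero : ∀ i : Fin N, ∃ y ∈ Set.Icc (κ / (2 * Real.pi * b i)) (κ / (2 * Real.pi * a i)),
      midlineSeries κ lam y = 0 := fun i => by
    refine exists_midlineSeries_eq_zero h (hapos i) (hab i) (le_trans ?_ hκ) (hua i) (hub i)
      (hsign i)
    have := hbN i i.2
    gcongr
  choose z hz hz0 using hzero
  have hanti : StrictAnti z := fun i j hij => by
    have hba : b i < a j := (hbl i).trans_le
      ((Nat.pow_le_pow_right (by norm_num) (Nat.succ_le_of_lt hij)).trans (hla j))
    have hba' : (b i : ℝ) < a j := by exact_mod_cast hba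
    have hb0 := hbpos i
    calc z j ≤ κ / (2 * Real.pi * a j) := (hz j).2
      _ < κ / (2 * Real.pi * b i) := by gcongr
      _ ≤ z i := (hz i).1
  refine ⟨Finset.univ.image z, ?_, ?_⟩
  · rw [Finset.card_image_of_injective _ hanti.injective, Finset.card_univ, Fintype.card_fin]
  · intro y hy
    obtain ⟨i, -, rfl⟩ := Finset.mem_image.1 hy
    refine ⟨le_trans ?_ (hz i).1, hz0 i⟩
    have := hbN i i.2
    have hb0 := hbpos i
    gcongr

/-- There are `C > 0` and `K` such that for every even `k ≥ K` and every
Hecke-multiplicative `λ`, `f_k` has at least `C log k` zeros on the segment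
`δ₂ = {Re z = 1/2, Im z ≥ √(k log k)}`. -/
theorem stmt_9 :
    ∃ C K : ℝ, 0 < C ∧
      ∀ k : ℕ, Even k → K ≤ (k : ℝ) →
        ∀ lam : ℕ → ℝ, HeckeMult lam →
          ∃ S : Finset ℝ,
            (∀ y ∈ S, Real.sqrt (k * Real.log k) ≤ y ∧
              fk k lam ((1 / 2 : ℝ) + (y : ℝ) * Complex.I) = 0) ∧
            C * Real.log k ≤ (S.card : ℝ) := by
  refine ⟨1 / 60, Real.exp 60, by norm_num, fun k _ hK lam h => ?_⟩
  have hk0 : (0 : ℝ) < k := (Real.exp_pos 60).trans_le hK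
  set L := Real.log k with hL
  have hL60 : 60 ≤ L := (Real.le_log_iff_exp_le hk0).2 hK
  set t := Real.exp (L / 6) with ht
  have hkt : (k : ℝ) = t ^ 6 := by
    rw [ht, ← Real.exp_nat_mul, ← Real.exp_log hk0]
    congr 1
    push_cast
    ring
  have ht1024 : 1024 ≤ t := by
    calc (1024 : ℝ) = 2 ^ 10 := by norm_num
      _ ≤ Real.exp 1 ^ 10 := by gcongr; linarith [Real.exp_one_gt_d9]
      _ = Real.exp 10 := by rw [← Real.exp_nat_mul]; norm_num
      _ ≤ t := Real.exp_le_exp.2 (by linarith)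
  have hLt : L ≤ 6 * t := by linarith [Real.add_one_le_exp (L / 6)]
  set N := ⌊L / 30⌋₊ with hN
  have hNle : (N : ℝ) ≤ L / 30 := Nat.floor_le (by linarith)
  have hNge : L / 30 < N + 1 := Nat.lt_floor_add_one _
  have hX : (81 : ℝ) ^ N ≤ t := by
    have h81 : (81 : ℝ) ≤ Real.exp 5 := by
      calc (81 : ℝ) ≤ 2.7 ^ 5 := by norm_num
        _ ≤ Real.exp 1 ^ 5 := by gcongr; linarith [Real.exp_one_gt_d9]
        _ = Real.exp 5 := by rw [← Real.exp_nat_mul]; norm_num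
    calc (81 : ℝ) ^ N ≤ Real.exp 5 ^ N := by gcongr
      _ = Real.exp (N * 5) := by rw [← Real.exp_nat_mul]
      _ ≤ t := Real.exp_le_exp.2 (by linarith)
  have ht3 : 1024 ^ 3 ≤ t ^ 3 := by gcongr
  have hκ : 120 * ((81 : ℝ) ^ N) ^ 3 ≤ ((k : ℝ) - 1) / 2 := by
    calc 120 * ((81 : ℝ) ^ N) ^ 3 ≤ 120 * t ^ 3 := by gcongr
      _ ≤ ((k : ℝ) - 1) / 2 := by rw [hkt]; nlinarith
  obtain ⟨S, hcard, hS⟩ := exists_finset_midlineSeries_eq_zero h N hκ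
  refine ⟨S, fun y hy => ⟨le_trans ?_ (hS y hy).1, ?_⟩, ?_⟩
  · have hpi : Real.pi ≤ 3.5 := by linarith [Real.pi_lt_d2]
    have hk21 : t ^ 5 / 21 ≤ ((k : ℝ) - 1) / 2 / (2 * Real.pi * 81 ^ N) := by
      calc t ^ 5 / 21 = (t ^ 6 / 3) / (2 * 3.5 * t) := by field_simp; norm_num
        _ ≤ ((k : ℝ) - 1) / 2 / (2 * Real.pi * 81 ^ N) := by
          have h3 : t ^ 6 / 3 ≤ ((k : ℝ) - 1) / 2 := by rw [hkt]; nlinarith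
          have : (0 : ℝ) ≤ t ^ 6 / 3 := by positivity
          gcongr
          linarith
    refine le_trans (Real.sqrt_le_left (by positivity) |>.2 ?_) hk21
    calc (k : ℝ) * L ≤ t ^ 6 * (6 * t) := by rw [hkt]; gcongr
      _ = 6 * t ^ 7 := by ring
      _ ≤ t ^ 3 / 441 * t ^ 7 := by gcongr; linarith
      _ = (t ^ 5 / 21) ^ 2 := by ring
  · rw [fk_half_add_mul_I, (hS y hy).2, Complex.ofReal_zero]
  · rw [hcard]
    linarith
end

section
/- Let λ : ℕ → ℝ be multiplicative (λ(mn) = λ(m)λ(n) whenever gcd(m,n) = 1) and satisfy λ(p)² = λ(p²) + 1 for every prime p. Then for every real ξ ≥ 1000 there exist six integers m₁, …, m₆, pairwise coprime, each lying in the open interval (ξ, 50ξ), with |λ(mᵢ)| ≥ 1/10 for each i. -/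
open Finset in
/-- The logarithms of the primes in `(n, 7n]` sum to `θ(7n) - θ(n)`, so Chebyshev's bounds
give many such primes. -/
lemma theta_sub_theta_le_card_mul_log (n : ℕ) :
    Chebyshev.theta ((7 * n : ℕ) : ℝ) - Chebyshev.theta (n : ℝ) ≤
      ((Ioc n (7 * n)).filter Nat.Prime).card * Real.log ((7 * n : ℕ) : ℝ) := by
  have hsplit : Chebyshev.theta ((7 * n : ℕ) : ℝ) = Chebyshev.theta (n : ℝ) +
      ∑ p ∈ (Ioc n (7 * n)).filter Nat.Prime, Real.log p := by
    unfold Chebyshev.theta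
    rw [Nat.floor_natCast, Nat.floor_natCast, ← Ioc_union_Ioc_eq_Ioc (Nat.zero_le n)
      (by omega : n ≤ 7 * n), filter_union, sum_union]
    exact disjoint_filter_filter (Ioc_disjoint_Ioc_of_le le_rfl)
  rw [hsplit, add_sub_cancel_left, ← nsmul_eq_mul]
  refine sum_le_card_nsmul _ _ _ fun p hp ↦ ?_
  simp only [mem_filter, mem_Ioc] at hp
  exact Real.log_le_log (by exact_mod_cast hp.2.pos) (by exact_mod_cast hp.1.2)

lemma log_le_sqrt_sqrt_div_two_add {y : ℝ} (hy : 0 < y) :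
    Real.log y ≤ √√y / 2 + 12 * Real.log 2 - 4 := by
  have ht : 0 < √√y := by positivity
  have h := Real.log_le_sub_one_of_pos (div_pos ht (by norm_num : (0 : ℝ) < 8))
  rw [Real.log_div ht.ne' (by norm_num), Real.log_sqrt (Real.sqrt_nonneg y),
    Real.log_sqrt hy.le, show (8 : ℝ) = 2 ^ 3 by norm_num, Real.log_pow] at h
  push_cast at h
  linarith

open Finset in
lemma twelve_le_card_primes_Ioc_of_large {n : ℕ} (hn : 601 ≤ n) :
    12 ≤ ((Ioc n (7 * n)).filter Nat.Prime).card := by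
  by_contra! hcard
  set k := ((Ioc n (7 * n)).filter Nat.Prime).card with hk
  have hk' : (k : ℝ) ≤ 11 := by exact_mod_cast Nat.le_of_lt_succ hcard
  have hsum := theta_sub_theta_le_card_mul_log n
  rw [← hk] at hsum
  have hlow := Chebyshev.theta_ge (7 * n)
  have hup := Chebyshev.theta_le_log4_mul_x (x := (n : ℝ)) (by positivity)
  rw [show (4 : ℝ) = 2 ^ 2 by norm_num, Real.log_pow] at hup
  set y : ℝ := ((7 * n : ℕ) : ℝ) with hy
  have hny : (n : ℝ) = y / 7 := by rw [hy]; push_cast; ring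
  have hy0 : (4207 : ℝ) ≤ y := by rw [hy]; exact_mod_cast (by omega : 4207 ≤ 7 * n)
  have hlog := log_le_sqrt_sqrt_div_two_add (y := y) (by linarith)
  have hlog0 : 0 ≤ Real.log y := Real.log_nonneg (by linarith)
  have hlog1 : Real.log (y + 1) ≤ Real.log y + 1 := by
    have h := Real.log_le_sub_one_of_pos (x := (y + 1) / y) (by positivity)
    rw [Real.log_div (by positivity) (by positivity)] at h
    have : (y + 1) / y ≤ 2 := by rw [div_le_iff₀ (by linarith)]; linarith
    linarith
  have ht2 : √√y ^ 2 = √y := Real.sq_sqrt (Real.sqrt_nonneg y)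
  have hs2 : √y ^ 2 = y := Real.sq_sqrt (by linarith)
  have ht8 : 8 ≤ √√y := by
    refine Real.le_sqrt_of_sq_le (Real.le_sqrt_of_sq_le ?_)
    norm_num
    linarith
  set t := √√y
  rw [← ht2] at hs2 hlow
  have hl1 := Real.log_two_gt_d9
  have hl2 := Real.log_two_lt_d9
  have hL : Real.log y ≤ t / 2 + 4.32 := by linarith
  have hkl : (k : ℝ) * Real.log y ≤ 11 * Real.log y := by gcongr
  have hmul : t ^ 2 * Real.log y ≤ t ^ 2 * (t / 2 + 4.32) := by gcongr
  have hmain : 5 / 7 * y * 0.69 ≤ 5 / 7 * y * Real.log 2 := by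
    gcongr
    linarith
  rw [hny] at hsum hup
  have hbound : 5 / 7 * y * 0.69 ≤ 12 * (t / 2 + 4.32) + 1 + 2 * (t ^ 2 * (t / 2 + 4.32)) := by
    nlinarith
  rw [← hs2] at hbound
  nlinarith [mul_nonneg (sub_nonneg.2 ht8) (sq_nonneg t),
    mul_nonneg (sub_nonneg.2 ht8) (pow_nonneg (by linarith : 0 ≤ t) 3), sq_nonneg (t - 8)]

open Finset in
lemma twelve_le_card_primes_Ioc {n : ℕ} (hn : 31 ≤ n) :
    12 ≤ ((Ioc n (7 * n)).filter Nat.Prime).card := by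
  rcases le_or_gt 601 n with h | h
  · exact twelve_le_card_primes_Ioc_of_large h
  · rcases le_or_gt n 100 with h' | h'
    · have hsub : ({101, 103, 107, 109, 113, 127, 131, 137, 139, 149, 151, 157} : Finset ℕ) ⊆
          (Ioc n (7 * n)).filter Nat.Prime := by
        intro p hp
        simp only [mem_insert, mem_singleton] at hp
        simp only [mem_filter, mem_Ioc]
        rcases hp with rfl | rfl | rfl | rfl | rfl | rfl | rfl | rfl | rfl | rfl | rfl | rfl <;>
          exact ⟨⟨by omega, by omega⟩, by norm_num⟩
      exact card_le_card hsub
    · have hsub : ({601, 607, 613, 617, 619, 631, 641, 643, 647, 653, 659, 661} : Finset ℕ) ⊆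
          (Ioc n (7 * n)).filter Nat.Prime := by
        intro p hp
        simp only [mem_insert, mem_singleton] at hp
        simp only [mem_filter, mem_Ioc]
        rcases hp with rfl | rfl | rfl | rfl | rfl | rfl | rfl | rfl | rfl | rfl | rfl | rfl <;>
          exact ⟨⟨by omega, by omega⟩, by norm_num⟩
      exact card_le_card hsub

/-- Among `p²`, `q²` and `pq` at least one has a large value of `lam`. -/
lemma exists_dvd_sq_large_abs {lam : ℕ → ℝ}
    (hmult : ∀ m n : ℕ, Nat.Coprime m n → lam (m * n) = lam m * lam n)
    (hhecke : ∀ p : ℕ, p.Prime → lam p ^ 2 = lam (p ^ 2) + 1)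
    {p q : ℕ} (hp : p.Prime) (hq : q.Prime) (hpq : p ≠ q) {x y : ℝ} (hx : 0 ≤ x)
    (hxp : x < p) (hpy : p ≤ y) (hxq : x < q) (hqy : q ≤ y) :
    ∃ m : ℕ, m ∣ (p * q) ^ 2 ∧ x ^ 2 < m ∧ m ≤ y ^ 2 ∧ (1 / 10 : ℝ) ≤ |lam m| := by
  by_cases h1 : (1 / 10 : ℝ) ≤ |lam (p ^ 2)|
  · refine ⟨p ^ 2, pow_dvd_pow_of_dvd (Dvd.intro _ rfl) 2, ?_, ?_, h1⟩ <;> push_cast <;> gcongr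
  by_cases h2 : (1 / 10 : ℝ) ≤ |lam (q ^ 2)|
  · refine ⟨q ^ 2, pow_dvd_pow_of_dvd (Dvd.intro_left _ rfl) 2, ?_, ?_, h2⟩ <;> push_cast <;> gcongr
  refine ⟨p * q, Dvd.intro_left _ (pow_two _).symm, ?_, ?_, ?_⟩
  · push_cast
    nlinarith
  · push_cast
    nlinarith
  · rw [hmult p q ((Nat.coprime_primes hp hq).2 hpq)]
    push Not at h1 h2
    have hp2 : 9 / 10 ≤ lam p ^ 2 := by linarith [hhecke p hp, (abs_lt.1 h1).1]
    have hq2 : 9 / 10 ≤ lam q ^ 2 := by linarith [hhecke q hq, (abs_lt.1 h2).1]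
    refine (abs_le_of_sq_le_sq' ?_ (abs_nonneg _)).2
    rw [sq_abs, mul_pow]
    nlinarith

/-- Let `λ : ℕ → ℝ` be multiplicative on coprime arguments with `λ(p)² = λ(p²) + 1` for
every prime `p`. Then for every `ξ ≥ 1000` there are six pairwise coprime integers in
`(ξ, 50ξ)` with `|λ(mᵢ)| ≥ 1/10`. -/
theorem stmt_11 (lam : ℕ → ℝ)
    (hmult : ∀ m n : ℕ, Nat.Coprime m n → lam (m * n) = lam m * lam n)
    (hhecke : ∀ p : ℕ, p.Prime → lam p ^ 2 = lam (p ^ 2) + 1) :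
    ∀ ξ : ℝ, 1000 ≤ ξ →
      ∃ m : Fin 6 → ℕ,
        (∀ i j, i ≠ j → Nat.Coprime (m i) (m j)) ∧
        ∀ i, ξ < (m i : ℝ) ∧ (m i : ℝ) < 50 * ξ ∧ (1 / 10 : ℝ) ≤ |lam (m i)| := by
  intro ξ hξ
  set x := √ξ
  have hx2 : x ^ 2 = ξ := Real.sq_sqrt (by linarith)
  have hx0 : 0 ≤ x := Real.sqrt_nonneg ξ
  have hn : 31 ≤ ⌊x⌋₊ := Nat.le_floor (Real.le_sqrt_of_sq_le (by norm_num; linarith))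
  obtain ⟨S, hS, hcard⟩ := Finset.exists_subset_card_eq (twelve_le_card_primes_Ioc hn)
  let P : Fin 12 → ℕ := fun i ↦ S.orderEmbOfFin hcard i
  have hinj : Function.Injective P := (S.orderEmbOfFin hcard).injective
  have hP (i : Fin 12) : (P i).Prime ∧ x < P i ∧ (P i : ℝ) ≤ 7 * x := by
    have h := hS (S.orderEmbOfFin_mem hcard i)
    simp only [Finset.mem_filter, Finset.mem_Ioc] at h
    refine ⟨h.2, (Nat.floor_lt hx0).1 h.1.1, ?_⟩
    calc (P i : ℝ) ≤ ((7 * ⌊x⌋₊ : ℕ) : ℝ) := by exact_mod_cast h.1.2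
      _ ≤ 7 * x := by
        push_cast
        linarith [Nat.floor_le hx0]
  let a (i : Fin 6) : Fin 12 := ⟨2 * i, by omega⟩
  let b (i : Fin 6) : Fin 12 := ⟨2 * i + 1, by omega⟩
  have hcop {i j : Fin 12} (hij : i ≠ j) : Nat.Coprime (P i) (P j) :=
    (Nat.coprime_primes (hP i).1 (hP j).1).2 (hinj.ne hij)
  have hex (i : Fin 6) := exists_dvd_sq_large_abs hmult hhecke (hP (a i)).1 (hP (b i)).1
    (hinj.ne (by simp [a, b])) hx0 (hP (a i)).2.1 (hP (a i)).2.2 (hP (b i)).2.1 (hP (b i)).2.2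
  choose m hdvd hlt hle hlam using hex
  refine ⟨m, fun i j hij ↦ ?_, fun i ↦ ⟨by linarith [hlt i], by nlinarith [hle i], hlam i⟩⟩
  have hij' : (i : ℕ) ≠ j := Fin.val_ne_of_ne hij
  refine Nat.Coprime.of_dvd (hdvd i) (hdvd j) (Nat.Coprime.pow 2 2 ?_)
  refine Nat.Coprime.mul_left (Nat.Coprime.mul_right ?_ ?_) (Nat.Coprime.mul_right ?_ ?_) <;>
    refine hcop (Fin.ne_of_val_ne ?_) <;> simp only [a, b] <;> omega
end

section
/- Let λ : ℕ → ℝ be multiplicative (λ(mn) = λ(m)λ(n) whenever gcd(m,n) = 1) and satisfy λ(p)² = λ(p²) + 1 for every prime p. Then for every real ξ ≥ 1000 there exist coprime integers m₁ and m₂, both lying in the open interval (ξ, 2500ξ), with λ(m₁) ≥ 1/100 and λ(m₂) ≥ 1/100. -/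
open Finset in
/-- Chebyshev's bounds give at least ten primes in `(X, 7X]`. -/
theorem ten_le_card_primes_Ioc {X : ℝ} (hX : 5000 ≤ X) :
    10 ≤ #{p ∈ Ioc ⌊X⌋₊ ⌊7 * X⌋₊ | p.Prime} := by
  by_contra! hlt
  set S : Finset ℕ := {p ∈ Ioc ⌊X⌋₊ ⌊7 * X⌋₊ | p.Prime}
  have hlog : 0 ≤ Real.log (7 * X) := Real.log_nonneg (by linarith)
  have hsplit : Chebyshev.theta (7 * X) ≤
      Chebyshev.theta X + ∑ p ∈ S, Real.log p := by
    unfold Chebyshev.theta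
    rw [← sum_union]
    · apply sum_le_sum_of_subset_of_nonneg
      · intro p hp
        simp only [S, mem_union, mem_filter, mem_Ioc] at hp ⊢
        have := hp.2
        rcases le_or_gt p ⌊X⌋₊ with h | h
        · exact Or.inl ⟨⟨hp.1.1, h⟩, this⟩
        · exact Or.inr ⟨⟨h, hp.1.2⟩, this⟩
      · intro p _ _
        exact Real.log_natCast_nonneg p
    · rw [disjoint_left]
      intro p hp hq
      simp only [S, mem_filter, mem_Ioc] at hp hq
      omega
  have hsum : ∑ p ∈ S, Real.log p ≤ 9 * Real.log (7 * X) := by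
    have h1 : ∑ p ∈ S, Real.log p ≤ #S • Real.log (7 * X) := by
      apply sum_le_card_nsmul
      intro p hp
      simp only [S, mem_filter, mem_Ioc] at hp
      apply Real.log_le_log (by exact_mod_cast hp.2.pos)
      exact (Nat.le_floor_iff (by linarith)).1 hp.1.2
    rw [nsmul_eq_mul] at h1
    have h2 : (#S : ℝ) ≤ 9 := by exact_mod_cast Nat.le_of_lt_succ hlt
    nlinarith
  have hlow := Chebyshev.theta_ge' (x := 7 * X) (by linarith)
  have hup := Chebyshev.theta_le_log4_mul_x (x := X) (by linarith)
  have hlog4 : Real.log 4 = 2 * Real.log 2 := by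
    rw [show (4 : ℝ) = 2 ^ 2 by norm_num, Real.log_pow]; norm_num
  have hlog_add : Real.log (7 * X + 2) ≤ 2 * Real.log (7 * X) := by
    have h := Real.log_le_log (x := 7 * X + 2) (y := (7 * X) ^ 2) (by linarith) (by nlinarith)
    rwa [Real.log_pow, Nat.cast_ofNat] at h
  obtain ⟨w, hw0, hw⟩ : ∃ w : ℝ, 0 ≤ w ∧ 7 * X = w ^ 4 :=
    ⟨√√(7 * X), Real.sqrt_nonneg _, by
      rw [show 4 = 2 * 2 from rfl, pow_mul, Real.sq_sqrt (Real.sqrt_nonneg _),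
        Real.sq_sqrt (by linarith)]⟩
  have hw13 : 13 ≤ w := by
    by_contra! h
    have : w ^ 4 < 13 ^ 4 := pow_lt_pow_left₀ h hw0 (by norm_num)
    linarith
  have hsqrt : √(7 * X) = w ^ 2 := by
    rw [hw, show w ^ 4 = (w ^ 2) ^ 2 by ring, Real.sqrt_sq (by positivity)]
  have hlogw : Real.log (7 * X) ≤ 2 * w - 1.2 := by
    have h := Real.log_le_sub_one_of_pos (x := w / 2) (by linarith)
    rw [Real.log_div (by linarith) (by norm_num)] at h
    rw [hw, Real.log_pow]
    push_cast
    linarith [Real.log_two_lt_d9]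
  rw [hsqrt] at hlow
  rw [hlog4] at hup
  have hl2 : 0.69 ≤ Real.log 2 := by linarith [Real.log_two_gt_d9]
  have h1 : Real.log 2 * (5 * X - 1) ≤ (11 + 2 * w ^ 2) * Real.log (7 * X) := by
    linarith
  have h2 : 0.69 * (5 * X - 1) ≤ Real.log 2 * (5 * X - 1) := by
    apply mul_le_mul_of_nonneg_right hl2; linarith
  have h3 : (11 + 2 * w ^ 2) * Real.log (7 * X) ≤ (11 + 2 * w ^ 2) * (2 * w - 1.2) := by
    apply mul_le_mul_of_nonneg_left hlogw; positivity
  have h4 : 13 * w ^ 3 ≤ w ^ 4 := by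
    rw [pow_succ w 3]; nlinarith [pow_nonneg hw0 3]
  have h5 : 169 * w ≤ w ^ 3 := by nlinarith [mul_nonneg hw0 (sub_nonneg.2 hw13)]
  nlinarith

/-- Ten primes whose pairwise products all lie in `(Y, 50Y)`. -/
theorem exists_ten_primes_mul_mem_Ioo {Y : ℝ} (hY : 31 ≤ Y) :
    ∃ S : Finset ℕ, 10 ≤ S.card ∧ (∀ p ∈ S, p.Prime) ∧
      ∀ p ∈ S, ∀ q ∈ S, p ≠ q → Y < ((p * q : ℕ) : ℝ) ∧ ((p * q : ℕ) : ℝ) < 50 * Y := by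
  have key : ∀ (S : Finset ℕ) (a b : ℕ), 10 ≤ S.card → (∀ p ∈ S, p.Prime) →
      (∀ p ∈ S, ∀ q ∈ S, p ≠ q → a ≤ p * q ∧ p * q < 50 * b) → Y < a → (b : ℝ) ≤ Y →
      ∃ S : Finset ℕ, 10 ≤ S.card ∧ (∀ p ∈ S, p.Prime) ∧
        ∀ p ∈ S, ∀ q ∈ S, p ≠ q → Y < ((p * q : ℕ) : ℝ) ∧ ((p * q : ℕ) : ℝ) < 50 * Y := by
    intro S a b hc hp h ha hb
    refine ⟨S, hc, hp, fun p hp q hq hpq => ?_⟩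
    obtain ⟨h1, h2⟩ := h p hp q hq hpq
    have h1' : (a : ℝ) ≤ ((p * q : ℕ) : ℝ) := Nat.cast_le.2 h1
    have h2' : ((p * q : ℕ) : ℝ) < ((50 * b : ℕ) : ℝ) := Nat.cast_lt.2 h2
    push_cast at h1' h2' ⊢
    constructor <;> linarith
  rcases lt_or_ge Y 77 with h | h
  · exact key {7, 11, 13, 17, 19, 23, 29, 31, 37, 41} 77 31 (by decide)
      (by simp only [Finset.mem_insert, Finset.mem_singleton, forall_eq_or_imp, forall_eq]
          norm_num) (by decide) (by exact_mod_cast h) (by exact_mod_cast hY)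
  rcases lt_or_ge Y 667 with h' | h'
  · exact key {23, 29, 31, 37, 41, 43, 47, 53, 59, 61} 667 77 (by decide)
      (by simp only [Finset.mem_insert, Finset.mem_singleton, forall_eq_or_imp, forall_eq]
          norm_num) (by decide) (by exact_mod_cast h') (by exact_mod_cast h)
  rcases lt_or_ge Y 16637 with h | h
  · exact key {127, 131, 137, 139, 149, 151, 157, 163, 167, 173} 16637 667 (by decide)
      (by simp only [Finset.mem_insert, Finset.mem_singleton, forall_eq_or_imp, forall_eq]
          norm_num) (by decide) (by exact_mod_cast h) (by exact_mod_cast h')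
  rcases lt_or_ge Y 695531 with h' | h'
  · exact key {829, 839, 853, 857, 859, 863, 877, 881, 883, 887} 695531 16637 (by decide)
      (by simp only [Finset.mem_insert, Finset.mem_singleton, forall_eq_or_imp, forall_eq]
          norm_num) (by decide) (by exact_mod_cast h') (by exact_mod_cast h)
  rcases lt_or_ge Y 25000000 with h | h
  · exact key {5689, 5693, 5701, 5711, 5717, 5737, 5741, 5743, 5749, 5779} 25000000 695531
      (by decide)
      (by simp only [Finset.mem_insert, Finset.mem_singleton, forall_eq_or_imp, forall_eq]
          norm_num) (by decide) (by exact_mod_cast h) (by exact_mod_cast h')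
  have hX : 5000 ≤ √Y := Real.le_sqrt_of_sq_le (by linarith)
  have hsq : √Y * √Y = Y := Real.mul_self_sqrt (by linarith)
  have hmem : ∀ p ∈ ({p ∈ Finset.Ioc ⌊√Y⌋₊ ⌊7 * √Y⌋₊ | p.Prime} : Finset ℕ),
      √Y < p ∧ (p : ℝ) ≤ 7 * √Y := by
    intro p hp
    simp only [Finset.mem_filter, Finset.mem_Ioc] at hp
    exact ⟨(Nat.floor_lt (by linarith)).1 hp.1.1, (Nat.le_floor_iff (by linarith)).1 hp.1.2⟩
  refine ⟨_, ten_le_card_primes_Ioc hX, fun p hp => (Finset.mem_filter.1 hp).2,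
    fun p hp q hq _ => ?_⟩
  obtain ⟨hp1, hp2⟩ := hmem p hp
  obtain ⟨hq1, hq2⟩ := hmem q hq
  push_cast
  constructor <;> nlinarith

/-- Among any four primes, two have a product `u` such that `λ(u²)` or `λ(u)` is positive and
bounded below. -/
theorem exists_pair_of_four_primes {lam : ℕ → ℝ} {S : Finset ℕ}
    (hmult : ∀ m n : ℕ, Nat.Coprime m n → lam (m * n) = lam m * lam n)
    (hhecke : ∀ p : ℕ, p.Prime → lam p ^ 2 = lam (p ^ 2) + 1)
    (hS : ∀ p ∈ S, p.Prime) (hcard : 4 ≤ S.card) :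
    ∃ p ∈ S, ∃ q ∈ S, p ≠ q ∧
      ((1 / 100 : ℝ) ≤ lam ((p * q) ^ 2) ∨ (1 / 10 : ℝ) ≤ lam (p * q)) := by
  classical
  let c : ℕ → Fin 3 := fun p => if 1 / 2 ≤ lam p then 0 else if lam p ≤ -(1 / 2) then 1 else 2
  obtain ⟨p, hp, q, hq, hpq, hc⟩ :=
    Finset.exists_ne_map_eq_of_card_lt_of_maps_to (s := S) (t := Finset.univ) (f := c)
      (by rw [Finset.card_univ, Fintype.card_fin]; omega) (fun _ _ => Finset.mem_coe.2 (Finset.mem_univ _))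
  refine ⟨p, hp, q, hq, hpq, ?_⟩
  have hcop : Nat.Coprime p q := (Nat.coprime_primes (hS p hp) (hS q hq)).2 hpq
  rw [mul_pow, hmult p q hcop, hmult _ _ (hcop.pow 2 2)]
  have hp2 := hhecke p (hS p hp)
  have hq2 := hhecke q (hS q hq)
  simp only [c] at hc
  split_ifs at hc <;> try exact absurd hc (by decide)
  · right; nlinarith
  · right; nlinarith
  · left
    push Not at *
    have hp3 : lam (p ^ 2) ≤ -(3 / 4) := by nlinarith
    have hq3 : lam (q ^ 2) ≤ -(3 / 4) := by nlinarith
    nlinarith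

/-- Ten primes contain four disjoint pairs with pairwise coprime products `u` such that `λ(u²)` or
`λ(u)` is positive and bounded below. -/
theorem exists_four_coprime_pairs {lam : ℕ → ℝ} {S : Finset ℕ}
    (hmult : ∀ m n : ℕ, Nat.Coprime m n → lam (m * n) = lam m * lam n)
    (hhecke : ∀ p : ℕ, p.Prime → lam p ^ 2 = lam (p ^ 2) + 1)
    (hS : ∀ p ∈ S, p.Prime) (k : ℕ) (hcard : 2 * k + 2 ≤ S.card) :
    ∃ u : Fin k → ℕ, (∀ i j, i ≠ j → Nat.Coprime (u i) (u j)) ∧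
      ∀ i, (∃ p ∈ S, ∃ q ∈ S, p ≠ q ∧ u i = p * q) ∧
        ((1 / 100 : ℝ) ≤ lam (u i ^ 2) ∨ (1 / 10 : ℝ) ≤ lam (u i)) := by
  induction k generalizing S with
  | zero => exact ⟨fun _ => 0, fun i => i.elim0, fun i => i.elim0⟩
  | succ k ih =>
    obtain ⟨p, hp, q, hq, hpq, hval⟩ :=
      exists_pair_of_four_primes hmult hhecke hS (by omega)
    have hsub : ∀ r ∈ (S.erase p).erase q, r ≠ q ∧ r ≠ p ∧ r ∈ S := fun r hr => by
      simpa only [Finset.mem_erase] using hr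
    have hc : ((S.erase p).erase q).card = S.card - 1 - 1 := by
      rw [Finset.card_erase_of_mem (Finset.mem_erase.2 ⟨hpq.symm, hq⟩),
        Finset.card_erase_of_mem hp]
    obtain ⟨u, hcop, hu⟩ := ih (S := (S.erase p).erase q)
      (fun r hr => hS r (hsub r hr).2.2) (by omega)
    have hnew : ∀ i, Nat.Coprime (p * q) (u i) := fun i => by
      obtain ⟨⟨r, hr, s, hs, -, hrs⟩, -⟩ := hu i
      obtain ⟨hrq, hrp, hr⟩ := hsub r hr
      obtain ⟨hsq, hsp, hs⟩ := hsub s hs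
      rw [hrs, Nat.coprime_mul_iff_left, Nat.coprime_mul_iff_right, Nat.coprime_mul_iff_right]
      simp only [Nat.coprime_primes, hS p hp, hS q hq, hS r hr, hS s hs]
      exact ⟨⟨hrp.symm, hsp.symm⟩, hrq.symm, hsq.symm⟩
    refine ⟨Fin.cons (p * q) u, ?_, ?_⟩
    · intro i j hij
      cases i using Fin.cases <;> cases j using Fin.cases
      · exact absurd rfl hij
      · simpa using hnew _
      · simpa using (hnew _).symm
      · simpa using hcop _ _ (fun h => hij (by rw [h]))
    · intro i
      cases i using Fin.cases with
      | zero => exact ⟨⟨p, hp, q, hq, hpq, by simp⟩, by simpa using hval⟩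
      | succ i =>
        obtain ⟨⟨r, hr, s, hs, hne, hrs⟩, hv⟩ := hu i
        exact ⟨⟨r, (hsub r hr).2.2, s, (hsub s hs).2.2, hne, by simpa using hrs⟩,
          by simpa using hv⟩


/-- Let `λ : ℕ → ℝ` be multiplicative on coprime arguments with `λ(p)² = λ(p²) + 1` for
every prime `p`. Then for every `ξ ≥ 1000` there are coprime integers `m₁, m₂` in
`(ξ, 2500ξ)` with `λ(m₁) ≥ 1/100` and `λ(m₂) ≥ 1/100`. -/
theorem stmt_12 (lam : ℕ → ℝ)
    (hmult : ∀ m n : ℕ, Nat.Coprime m n → lam (m * n) = lam m * lam n)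
    (hhecke : ∀ p : ℕ, p.Prime → lam p ^ 2 = lam (p ^ 2) + 1) :
    ∀ ξ : ℝ, 1000 ≤ ξ →
      ∃ m₁ m₂ : ℕ, Nat.Coprime m₁ m₂ ∧
        ξ < (m₁ : ℝ) ∧ (m₁ : ℝ) < 2500 * ξ ∧
        ξ < (m₂ : ℝ) ∧ (m₂ : ℝ) < 2500 * ξ ∧
        (1 / 100 : ℝ) ≤ lam m₁ ∧ (1 / 100 : ℝ) ≤ lam m₂ := by
  intro ξ hξ
  have hY : 31 ≤ √ξ := Real.le_sqrt_of_sq_le (by linarith)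
  have hsq : √ξ * √ξ = ξ := Real.mul_self_sqrt (by linarith)
  obtain ⟨S, hcard, hS, hprod⟩ := exists_ten_primes_mul_mem_Ioo hY
  obtain ⟨u, hcop, hu⟩ := exists_four_coprime_pairs hmult hhecke hS 4 hcard
  have hrange : ∀ i j, ξ < ((u i * u j : ℕ) : ℝ) ∧ ((u i * u j : ℕ) : ℝ) < 2500 * ξ := by
    have hmem : ∀ i, √ξ < u i ∧ (u i : ℝ) < 50 * √ξ := fun i => by
      obtain ⟨⟨p, hp, q, hq, hpq, h⟩, -⟩ := hu i
      rw [h]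
      exact hprod p hp q hq hpq
    intro i j
    obtain ⟨hi1, hi2⟩ := hmem i
    obtain ⟨hj1, hj2⟩ := hmem j
    push_cast
    constructor <;> nlinarith
  have hpair : ∀ i j k l, Nat.Coprime (u i * u j) (u k * u l) →
      (1 / 100 : ℝ) ≤ lam (u i * u j) → (1 / 100 : ℝ) ≤ lam (u k * u l) →
      ∃ m₁ m₂ : ℕ, Nat.Coprime m₁ m₂ ∧
        ξ < (m₁ : ℝ) ∧ (m₁ : ℝ) < 2500 * ξ ∧
        ξ < (m₂ : ℝ) ∧ (m₂ : ℝ) < 2500 * ξ ∧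
        (1 / 100 : ℝ) ≤ lam m₁ ∧ (1 / 100 : ℝ) ≤ lam m₂ :=
    fun i j k l hc h1 h2 => ⟨_, _, hc, (hrange i j).1, (hrange i j).2, (hrange k l).1,
      (hrange k l).2, h1, h2⟩
  have hmul : ∀ i j, i ≠ j → (1 / 10 : ℝ) ≤ lam (u i) → (1 / 10 : ℝ) ≤ lam (u j) →
      (1 / 100 : ℝ) ≤ lam (u i * u j) := fun i j hij hi hj => by
    rw [hmult _ _ (hcop i j hij)]
    nlinarith
  have hcop2 : ∀ i j k l, i ≠ k → i ≠ l → j ≠ k → j ≠ l →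
      Nat.Coprime (u i * u j) (u k * u l) := fun i j k l hik hil hjk hjl =>
    Nat.Coprime.mul_left (Nat.Coprime.mul_right (hcop _ _ hik) (hcop _ _ hil))
      (Nat.Coprime.mul_right (hcop _ _ hjk) (hcop _ _ hjl))
  have hval : ∀ i, (1 / 100 : ℝ) ≤ lam (u i * u i) ∨ (1 / 10 : ℝ) ≤ lam (u i) := fun i => by
    rw [← sq]
    exact (hu i).2
  have hss : ∀ i j, i ≠ j → (1 / 100 : ℝ) ≤ lam (u i * u i) → (1 / 100 : ℝ) ≤ lam (u j * u j) → _ :=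
    fun i j hij => hpair i i j j (hcop2 _ _ _ _ hij hij hij hij)
  have hsm : ∀ i j k, i ≠ j → i ≠ k → j ≠ k → (1 / 100 : ℝ) ≤ lam (u i * u i) →
      (1 / 10 : ℝ) ≤ lam (u j) → (1 / 10 : ℝ) ≤ lam (u k) → _ :=
    fun i j k hij hik hjk hi hj hk => hpair i i j k (hcop2 _ _ _ _ hij hik hij hik) hi
      (hmul j k hjk hj hk)
  rcases hval 0 with h0 | h0 <;> rcases hval 1 with h1 | h1
  · exact hss 0 1 (by decide) h0 h1
  · rcases hval 2 with h2 | h2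
    · exact hss 0 2 (by decide) h0 h2
    · exact hsm 0 1 2 (by decide) (by decide) (by decide) h0 h1 h2
  · rcases hval 2 with h2 | h2
    · exact hss 1 2 (by decide) h1 h2
    · exact hsm 1 0 2 (by decide) (by decide) (by decide) h1 h0 h2
  · rcases hval 2 with h2 | h2
    · exact hsm 2 0 1 (by decide) (by decide) (by decide) h2 h0 h1
    · rcases hval 3 with h3 | h3
      · exact hsm 3 0 1 (by decide) (by decide) (by decide) h3 h0 h1
      · exact hpair 0 1 2 3 (hcop2 _ _ _ _ (by decide) (by decide) (by decide) (by decide))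
          (hmul 0 1 (by decide) h0 h1) (hmul 2 3 (by decide) h2 h3)
end

section
/- For every ε₀ > 0 there exist C > 0 and K such that the following holds: for every even integer k ≥ K and every Hecke-multiplicative λ for which there exists a prime power n̂ with n̂ < k^{0.4963} and λ(n̂) ≤ −ε₀, there are at least C log k distinct real numbers y ≥ √(k log k) with f_k(iy) = 0; that is, f_k has at least C log k zeros on the segment δ₁ = {Re z = 0, Im z ≥ √(k log k)}. -/
theorem HeckeMult.prime_pow_add_two {lam : ℕ → ℝ} (h : HeckeMult lam) {p : ℕ} (hp : p.Prime)
    (n : ℕ) : lam (p ^ (n + 2)) = lam p * lam (p ^ (n + 1)) - lam (p ^ n) := by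
  have := h.2.2.1 p (n + 1) hp (by omega)
  simp only [Nat.add_sub_cancel] at this
  linarith

theorem HeckeMult.abs_prime_pow_le_s13 {lam : ℕ → ℝ} (h : HeckeMult lam) {p : ℕ} (hp : p.Prime)
    (n : ℕ) : |lam (p ^ n)| ≤ ((p ^ n : ℕ) : ℝ) ^ 2 := by
  have hp2 : (2 : ℝ) ≤ p := by exact_mod_cast hp.two_le
  have hx := h.2.2.2 p hp
  induction n using Nat.twoStepInduction with
  | zero => simp [h.1]
  | one => simp only [pow_one]; nlinarith
  | more n ih1 ih2 =>
    rw [h.prime_pow_add_two hp]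
    push_cast at *
    have hP : (0 : ℝ) ≤ ((p : ℝ) ^ n) ^ 2 := by positivity
    calc |lam p * lam (p ^ (n + 1)) - lam (p ^ n)|
        ≤ |lam p| * |lam (p ^ (n + 1))| + |lam (p ^ n)| := by
          rw [← abs_mul]; exact abs_sub _ _
      _ ≤ 2 * ((p : ℝ) ^ (n + 1)) ^ 2 + ((p : ℝ) ^ n) ^ 2 := by gcongr
      _ = (2 * (p : ℝ) ^ 2 + 1) * ((p : ℝ) ^ n) ^ 2 := by ring
      _ ≤ ((p : ℝ) ^ 2 * (p : ℝ) ^ 2) * ((p : ℝ) ^ n) ^ 2 := by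
          gcongr
          nlinarith [mul_self_nonneg ((p : ℝ) ^ 2 - 4)]
      _ = ((p : ℝ) ^ (n + 2)) ^ 2 := by ring

theorem HeckeMult.abs_le_sq_s13 {lam : ℕ → ℝ} (h : HeckeMult lam) {n : ℕ} (hn : n ≠ 0) :
    |lam n| ≤ (n : ℝ) ^ 2 := by
  induction n using Nat.recOnPosPrimePosCoprime with
  | zero => exact absurd rfl hn
  | one => simp [h.1]
  | prime_pow p n hp _ => exact h.abs_prime_pow_le_s13 hp n
  | coprime a b ha hb hab iha ihb =>
    rw [h.2.1 a b hab, abs_mul, Nat.cast_mul, mul_pow]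
    exact mul_le_mul (iha (by omega)) (ihb (by omega)) (abs_nonneg _) (by positivity)

theorem HeckeMult.prime_pow_quadratic_s13 {lam : ℕ → ℝ} (h : HeckeMult lam) {p : ℕ} (hp : p.Prime)
    (n : ℕ) : lam (p ^ (n + 1)) ^ 2 - lam p * lam (p ^ n) * lam (p ^ (n + 1)) + lam (p ^ n) ^ 2
      = 1 := by
  induction n with
  | zero => simp [h.1]; ring
  | succ n ih => rw [h.prime_pow_add_two hp]; linear_combination ih

theorem HeckeMult.half_le_abs_prime_pow_or {lam : ℕ → ℝ} (h : HeckeMult lam) {p : ℕ}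
    (hp : p.Prime) (n : ℕ) : 1 / 2 ≤ |lam (p ^ n)| ∨ 1 / 2 ≤ |lam (p ^ (n + 1))| := by
  by_contra! hc
  obtain ⟨h1, h2⟩ := hc
  have hq := h.prime_pow_quadratic_s13 hp n
  have hx := h.2.2.2 p hp
  rw [← sq_abs (lam (p ^ n)), ← sq_abs (lam (p ^ (n + 1)))] at hq
  have hb : -(lam p * lam (p ^ n) * lam (p ^ (n + 1)))
      ≤ 2 * |lam (p ^ n)| * |lam (p ^ (n + 1))| := by
    refine (neg_le_abs _).trans ?_
    rw [abs_mul, abs_mul]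
    gcongr
  nlinarith [abs_nonneg (lam (p ^ n)), abs_nonneg (lam (p ^ (n + 1)))]

theorem HeckeMult.exists_prime_pow_near {lam : ℕ → ℝ} (h : HeckeMult lam) {q : ℕ}
    (hq : q.Prime) {Y : ℝ} (hY : 1 ≤ Y) :
    ∃ a : ℕ, Y ≤ (q : ℝ) ^ a ∧ (q : ℝ) ^ a ≤ (q : ℝ) ^ 2 * Y ∧ 1 / 2 ≤ |lam (q ^ a)| := by
  have hq1 : (1 : ℝ) < q := by exact_mod_cast hq.one_lt
  obtain ⟨n, hn1, hn2⟩ := exists_nat_pow_near hY hq1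
  have hup : (q : ℝ) ^ (n + 2) ≤ (q : ℝ) ^ 2 * Y := by
    rw [pow_add, mul_comm]; gcongr
  have hmono : (q : ℝ) ^ (n + 1) ≤ (q : ℝ) ^ (n + 2) := pow_le_pow_right₀ hq1.le (by omega)
  rcases h.half_le_abs_prime_pow_or hq (n + 1) with h1 | h1
  · exact ⟨n + 1, hn2.le, hmono.trans hup, h1⟩
  · exact ⟨n + 2, hn2.le.trans hmono, hup, h1⟩

theorem exists_mul_pos_of_three {a b c : ℝ} (ha : 1 / 2 ≤ |a|) (hb : 1 / 2 ≤ |b|)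
    (hc : 1 / 2 ≤ |c|) : 1 / 4 ≤ a * b ∨ 1 / 4 ≤ a * c ∨ 1 / 4 ≤ b * c := by
  have key : ∀ x y : ℝ, 1 / 2 ≤ |x| → 1 / 2 ≤ |y| → 0 ≤ x * y → 1 / 4 ≤ x * y := by
    intro x y hx hy hxy
    rw [← abs_of_nonneg hxy, abs_mul]
    nlinarith
  rcases le_total 0 a with h1 | h1 <;> rcases le_total 0 b with h2 | h2 <;>
    rcases le_total 0 c with h3 | h3 <;>
    first
    | exact Or.inl (key _ _ ha hb (by nlinarith))
    | exact Or.inr (Or.inl (key _ _ ha hc (by nlinarith)))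
    | exact Or.inr (Or.inr (key _ _ hb hc (by nlinarith)))

theorem exists_three_small_primes_ne (p : ℕ) : ∃ q₁ q₂ q₃ : ℕ,
    (q₁.Prime ∧ q₁ ≤ 7 ∧ q₁ ≠ p) ∧ (q₂.Prime ∧ q₂ ≤ 7 ∧ q₂ ≠ p) ∧ (q₃.Prime ∧ q₃ ≤ 7 ∧ q₃ ≠ p) ∧
      q₁ ≠ q₂ ∧ q₁ ≠ q₃ ∧ q₂ ≠ q₃ := by
  have h5 : Nat.Prime 5 := by norm_num
  have h7 : Nat.Prime 7 := by norm_num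
  by_cases h2p : p = 2
  · exact ⟨3, 5, 7, ⟨Nat.prime_three, by omega, by omega⟩, ⟨h5, by omega, by omega⟩,
      ⟨h7, by omega, by omega⟩, by omega, by omega, by omega⟩
  by_cases h3p : p = 3
  · exact ⟨2, 5, 7, ⟨Nat.prime_two, by omega, by omega⟩, ⟨h5, by omega, by omega⟩,
      ⟨h7, by omega, by omega⟩, by omega, by omega, by omega⟩
  by_cases h5p : p = 5
  · exact ⟨2, 3, 7, ⟨Nat.prime_two, by omega, by omega⟩, ⟨Nat.prime_three, by omega, by omega⟩,
      ⟨h7, by omega, by omega⟩, by omega, by omega, by omega⟩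
  · exact ⟨2, 3, 5, ⟨Nat.prime_two, by omega, by omega⟩, ⟨Nat.prime_three, by omega, by omega⟩,
      ⟨h5, by omega, by omega⟩, by omega, by omega, by omega⟩

/-- Every interval `[Y, 2402 Y)` contains an integer coprime to `p` with `λ ≥ 1/4`: among powers of
three distinct primes of size about `√Y`, two have `λ`-values of the same sign. -/
theorem HeckeMult.exists_pos_near {lam : ℕ → ℝ} (h : HeckeMult lam) {p : ℕ} (hp : p.Prime)
    {Y : ℝ} (hY : 1 ≤ Y) :
    ∃ m : ℕ, m.Coprime p ∧ Y ≤ m ∧ (m : ℝ) < 2402 * Y ∧ 1 / 4 ≤ lam m := by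
  have hs : 1 ≤ √Y := Real.one_le_sqrt.mpr hY
  have hss : √Y * √Y = Y := Real.mul_self_sqrt (by linarith)
  have key : ∀ q r a b : ℕ, q.Prime ∧ q ≤ 7 ∧ q ≠ p → r.Prime ∧ r ≤ 7 ∧ r ≠ p → q ≠ r →
      √Y ≤ (q : ℝ) ^ a → (q : ℝ) ^ a ≤ (q : ℝ) ^ 2 * √Y →
      √Y ≤ (r : ℝ) ^ b → (r : ℝ) ^ b ≤ (r : ℝ) ^ 2 * √Y →
      1 / 4 ≤ lam (q ^ a) * lam (r ^ b) →
      ∃ m : ℕ, m.Coprime p ∧ Y ≤ m ∧ (m : ℝ) < 2402 * Y ∧ 1 / 4 ≤ lam m := by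
    rintro q r a b ⟨hq, hq7, hqp⟩ ⟨hr, hr7, hrp⟩ hqr ha1 ha2 hb1 hb2 hab
    have hq7' : (q : ℝ) ≤ 7 := by exact_mod_cast hq7
    have hr7' : (r : ℝ) ≤ 7 := by exact_mod_cast hr7
    refine ⟨q ^ a * r ^ b, ?_, ?_, ?_, ?_⟩
    · exact Nat.Coprime.mul_left (((Nat.coprime_primes hq hp).mpr hqp).pow_left a)
        (((Nat.coprime_primes hr hp).mpr hrp).pow_left b)
    · push_cast
      rw [← hss]
      gcongr
    · push_cast
      calc (q : ℝ) ^ a * (r : ℝ) ^ b ≤ (7 ^ 2 * √Y) * (7 ^ 2 * √Y) := by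
            gcongr
            · exact ha2.trans (by gcongr)
            · exact hb2.trans (by gcongr)
        _ = 2401 * (√Y * √Y) := by ring
        _ < 2402 * Y := by rw [hss]; linarith
    · rwa [h.2.1 _ _ (Nat.Coprime.pow a b ((Nat.coprime_primes hq hr).mpr hqr))]
  obtain ⟨q₁, q₂, q₃, h1, h2, h3, h12, h13, h23⟩ := exists_three_small_primes_ne p
  obtain ⟨a, ha1, ha2, ha3⟩ := h.exists_prime_pow_near h1.1 hs
  obtain ⟨b, hb1, hb2, hb3⟩ := h.exists_prime_pow_near h2.1 hs
  obtain ⟨c, hc1, hc2, hc3⟩ := h.exists_prime_pow_near h3.1 hs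
  rcases exists_mul_pos_of_three ha3 hb3 hc3 with H | H | H
  · exact key q₁ q₂ a b h1 h2 h12 ha1 ha2 hb1 hb2 H
  · exact key q₁ q₃ a c h1 h3 h13 ha1 ha2 hc1 hc2 H
  · exact key q₂ q₃ b c h2 h3 h23 hb1 hb2 hc1 hc2 H

/-- The restriction of `fk` to the imaginary axis, as a real function. -/
noncomputable def fkAxis (k : ℕ) (lam : ℕ → ℝ) (y : ℝ) : ℝ :=
  ∑' n : ℕ, lam (n + 1) * (((n + 1 : ℕ) : ℝ) ^ (((k : ℝ) - 1) / 2) *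
    Real.exp (-(2 * Real.pi * (n + 1 : ℕ) * y)))

theorem fk_mul_I (k : ℕ) (lam : ℕ → ℝ) (y : ℝ) :
    fk k lam ((y : ℝ) * Complex.I) = (fkAxis k lam y : ℂ) := by
  unfold fk fkAxis
  rw [Complex.ofReal_tsum]
  refine tsum_congr fun n => ?_
  have : (2 * Real.pi * Complex.I * (n + 1 : ℕ) * ((y : ℝ) * Complex.I) : ℂ)
      = ((-(2 * Real.pi * (n + 1 : ℕ) * y) : ℝ) : ℂ) := by
    push_cast
    linear_combination (2 * (Real.pi : ℂ) * (n + 1) * y) * Complex.I_mul_I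
  rw [this, ← Complex.ofReal_exp]
  push_cast
  ring

theorem HeckeMult.norm_term_le {lam : ℕ → ℝ} (h : HeckeMult lam) (k : ℕ) {a y : ℝ}
    (hay : a ≤ y) (n : ℕ) :
    ‖lam (n + 1) * (((n + 1 : ℕ) : ℝ) ^ (((k : ℝ) - 1) / 2) *
      Real.exp (-(2 * Real.pi * (n + 1 : ℕ) * y)))‖ ≤
    ((n + 1 : ℕ) : ℝ) ^ (k + 2) * Real.exp (-(2 * Real.pi * a) * (n + 1 : ℕ)) := by
  have hn : (1 : ℝ) ≤ ((n + 1 : ℕ) : ℝ) := by exact_mod_cast Nat.succ_le_succ (Nat.zero_le n)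
  have hpi := Real.pi_pos
  rw [norm_mul, Real.norm_eq_abs, Real.norm_of_nonneg (by positivity), pow_add,
    mul_comm (((n + 1 : ℕ) : ℝ) ^ k), mul_assoc (((n + 1 : ℕ) : ℝ) ^ 2)]
  refine mul_le_mul ?_ (mul_le_mul ?_ (Real.exp_le_exp.mpr ?_) (Real.exp_nonneg _)
    (by positivity)) (by positivity) (by positivity)
  · exact h.abs_le_sq_s13 (Nat.succ_ne_zero n)
  · rw [← Real.rpow_natCast]
    refine Real.rpow_le_rpow_of_exponent_le hn ?_
    have : (0 : ℝ) ≤ k := k.cast_nonneg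
    linarith
  · have := mul_le_mul_of_nonneg_left hay (by positivity : 0 ≤ 2 * Real.pi * ((n + 1 : ℕ) : ℝ))
    linarith

theorem summable_pow_mul_exp_succ (k : ℕ) {a : ℝ} (ha : 0 < a) :
    Summable fun n : ℕ =>
      ((n + 1 : ℕ) : ℝ) ^ (k + 2) * Real.exp (-(2 * Real.pi * a) * (n + 1 : ℕ)) :=
  (summable_nat_add_iff 1).mpr
    (Real.summable_pow_mul_exp_neg_nat_mul (k + 2) (by positivity : 0 < 2 * Real.pi * a))

theorem HeckeMult.continuousOn_fkAxis {lam : ℕ → ℝ} (h : HeckeMult lam) (k : ℕ) {a b : ℝ}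
    (ha : 0 < a) : ContinuousOn (fkAxis k lam) (Set.Icc a b) := by
  unfold fkAxis
  refine continuousOn_tsum (fun n => ?_) (summable_pow_mul_exp_succ k ha)
    (fun n y hy => h.norm_term_le k hy.1 n)
  fun_prop

theorem rpow_mul_exp_neg_le {κ t : ℝ} (hκ : 0 ≤ κ) (ht : 0 < t) :
    t ^ κ * Real.exp (-(κ * (t - 1))) ≤ Real.exp (-(κ * (√t - 1) ^ 2)) := by
  rw [Real.rpow_def_of_pos ht, ← Real.exp_add]
  refine Real.exp_le_exp.mpr ?_
  have h1 : Real.log t ≤ 2 * (√t - 1) := by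
    have := Real.log_le_sub_one_of_pos (Real.sqrt_pos.mpr ht)
    rw [Real.log_sqrt ht.le] at this
    linarith
  have h2 : √t ^ 2 = t := Real.sq_sqrt ht.le
  nlinarith [mul_le_mul_of_nonneg_left h1 hκ]

theorem le_sqrt_sub_one_sq {m n : ℕ} (hm : 1 ≤ m) (hn : 1 ≤ n) (hmn : n ≠ m) :
    |(n : ℝ) - m| / (6 * (m : ℝ) ^ 2) ≤ (√((n : ℝ) / m) - 1) ^ 2 := by
  have hm' : (1 : ℝ) ≤ m := by exact_mod_cast hm
  have hn' : (1 : ℝ) ≤ n := by exact_mod_cast hn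
  have hd : (1 : ℝ) ≤ |(n : ℝ) - m| := by
    have : (1 : ℤ) ≤ |(n : ℤ) - m| := Int.one_le_abs (by omega)
    exact_mod_cast this
  set s := √((n : ℝ) / m) with hs
  have hs0 : 0 ≤ s := Real.sqrt_nonneg _
  have hss : s ^ 2 * m = n := by
    rw [hs, Real.sq_sqrt (by positivity)]; field_simp
  set d := |(n : ℝ) - m| with hd'
  have hdd : d = |s - 1| * (s + 1) * m := by
    rw [hd', ← hss, show s ^ 2 * m - m = (s - 1) * (s + 1) * m by ring, abs_mul, abs_mul,
      abs_of_nonneg (by linarith : 0 ≤ s + 1), abs_of_nonneg (by linarith : (0 : ℝ) ≤ m)]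
  have hnd : (n : ℝ) ≤ m + d := by linarith [le_abs_self ((n : ℝ) - m)]
  have hs1 : (s + 1) ^ 2 * m ≤ 6 * (m : ℝ) * d := by
    have : (s + 1) ^ 2 ≤ 2 * (s ^ 2 + 1) := by nlinarith [sq_nonneg (s - 1)]
    calc (s + 1) ^ 2 * m ≤ 2 * (s ^ 2 + 1) * m := by gcongr
      _ = 2 * ((n : ℝ) + m) := by rw [← hss]; ring
      _ ≤ 6 * m * d := by nlinarith
  rw [div_le_iff₀ (by positivity)]
  have hsq : d ^ 2 = (s - 1) ^ 2 * ((s + 1) ^ 2 * m) * m := by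
    rw [hdd, mul_pow, mul_pow, sq_abs]; ring
  have : d * d ≤ ((s - 1) ^ 2 * (6 * (m : ℝ) ^ 2)) * d := by
    calc d * d = (s - 1) ^ 2 * ((s + 1) ^ 2 * m) * m := by rw [← hsq]; ring
      _ ≤ (s - 1) ^ 2 * (6 * (m : ℝ) * d) * m := by gcongr
      _ = _ := by ring
  exact le_of_mul_le_mul_right this (by linarith)

/-- The off-peak terms of `f_k` at height `(k-1)/(4πm)` are negligible. -/
theorem HeckeMult.off_peak_le {lam : ℕ → ℝ} (h : HeckeMult lam) {k m n : ℕ} (hk : 3 ≤ k)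
    (hm : 1 ≤ m) (hn : 1 ≤ n) (hmn : n ≠ m)
    (hkm : √(k * Real.log k) ≤ ((k : ℝ) - 1) / 2 / (2 * Real.pi * m)) :
    |lam n| * (((n : ℝ) / m) ^ (((k : ℝ) - 1) / 2) *
      Real.exp (-(((k : ℝ) - 1) / 2 * ((n : ℝ) / m - 1)))) ≤ 1 / k * (1 / (n : ℝ) ^ 2) := by
  have hk' : (3 : ℝ) ≤ k := by exact_mod_cast hk
  have hm' : (1 : ℝ) ≤ m := by exact_mod_cast hm
  have hn' : (1 : ℝ) ≤ n := by exact_mod_cast hn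
  have hd : (1 : ℝ) ≤ |(n : ℝ) - m| := by
    have : (1 : ℤ) ≤ |(n : ℤ) - m| := Int.one_le_abs (by omega)
    exact_mod_cast this
  set κ := ((k : ℝ) - 1) / 2 with hκ
  set L := Real.log k with hL
  have hκ1 : 1 ≤ κ := by rw [hκ]; linarith
  have hkexp : Real.exp L = k := Real.exp_log (by linarith)
  have hL1 : 1 ≤ L := by
    rw [hL, Real.le_log_iff_exp_le (by linarith)]
    linarith [Real.exp_one_lt_d9]
  set d := |(n : ℝ) - m| with hd'
  have hpi := Real.pi_gt_three
  have hmul : 36 * (k * L) * (m : ℝ) ^ 2 ≤ κ ^ 2 := by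
    have h1 : √(k * L) * (6 * m) ≤ κ := by
      rw [le_div_iff₀ (by positivity)] at hkm
      refine le_trans ?_ hkm
      gcongr
      linarith
    have h2 := pow_le_pow_left₀ (by positivity) h1 2
    rw [mul_pow, Real.sq_sqrt (by positivity)] at h2
    linarith
  have hkκ : 2 * κ ≤ k := by rw [hκ]; linarith
  have hpeak : 12 * L ≤ κ / (6 * (m : ℝ) ^ 2) := by
    rw [le_div_iff₀ (by positivity)]
    have : 72 * L * (m : ℝ) ^ 2 * κ ≤ κ * κ := by
      calc 72 * L * (m : ℝ) ^ 2 * κ = 36 * L * (m : ℝ) ^ 2 * (2 * κ) := by ring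
        _ ≤ 36 * L * (m : ℝ) ^ 2 * k := by gcongr
        _ ≤ κ * κ := by linarith
    have := le_of_mul_le_mul_right this (by linarith)
    linarith
  have hw : ((n : ℝ) / m) ^ κ * Real.exp (-(κ * ((n : ℝ) / m - 1))) ≤
      Real.exp (-(12 * L * d)) := by
    refine (rpow_mul_exp_neg_le (by linarith) (by positivity)).trans ?_
    refine Real.exp_le_exp.mpr (neg_le_neg ?_)
    calc 12 * L * d ≤ κ / (6 * (m : ℝ) ^ 2) * d := by gcongr
      _ = κ * (d / (6 * (m : ℝ) ^ 2)) := by ring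
      _ ≤ _ := by gcongr; exact le_sqrt_sub_one_sq hm hn hmn
  have hm2 : (m : ℝ) ^ 2 ≤ Real.exp L := by
    rw [hkexp]
    have h1 : (k * 1) * (m : ℝ) ^ 2 ≤ (k : ℝ) * k := by
      calc (k * 1) * (m : ℝ) ^ 2 ≤ (k * L) * (m : ℝ) ^ 2 := by gcongr
        _ ≤ 36 * (k * L) * (m : ℝ) ^ 2 := by
          have : 0 ≤ (k * L) * (m : ℝ) ^ 2 := by positivity
          linarith
        _ ≤ κ ^ 2 := hmul
        _ ≤ (k : ℝ) * k := by nlinarith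
    nlinarith
  have hnexp : (n : ℝ) ≤ m * Real.exp (L * d) := by
    have h1 : (n : ℝ) ≤ m + d := by linarith [le_abs_self ((n : ℝ) - m)]
    have h2 : 1 + d ≤ Real.exp (L * d) := by
      have := Real.add_one_le_exp (L * d)
      nlinarith
    nlinarith
  have hn4 : (n : ℝ) ^ 4 ≤ Real.exp (6 * L * d) := by
    calc (n : ℝ) ^ 4 ≤ (m * Real.exp (L * d)) ^ 4 := by gcongr
      _ = ((m : ℝ) ^ 2) ^ 2 * Real.exp (L * d) ^ 4 := by ring
      _ ≤ Real.exp L ^ 2 * Real.exp (L * d) ^ 4 := by gcongr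
      _ = Real.exp (2 * L + 4 * (L * d)) := by
          rw [← Real.exp_nat_mul, ← Real.exp_nat_mul, ← Real.exp_add]; norm_num
      _ ≤ Real.exp (6 * L * d) := by
          refine Real.exp_le_exp.mpr ?_
          nlinarith
  rw [show 1 / (k : ℝ) * (1 / (n : ℝ) ^ 2) = 1 / k / (n : ℝ) ^ 2 by ring,
    le_div_iff₀ (by positivity)]
  calc |lam n| * (((n : ℝ) / m) ^ κ * Real.exp (-(κ * ((n : ℝ) / m - 1)))) * (n : ℝ) ^ 2
      ≤ (n : ℝ) ^ 2 * Real.exp (-(12 * L * d)) * (n : ℝ) ^ 2 := by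
        gcongr
        exact h.abs_le_sq_s13 (by omega)
    _ = (n : ℝ) ^ 4 * Real.exp (-(12 * L * d)) := by ring
    _ ≤ Real.exp (6 * L * d) * Real.exp (-(12 * L * d)) := by gcongr
    _ = Real.exp (-(6 * L * d)) := by rw [← Real.exp_add]; ring_nf
    _ ≤ Real.exp (-L) := by
        refine Real.exp_le_exp.mpr ?_
        nlinarith
    _ = 1 / k := by rw [Real.exp_neg, hkexp, one_div]

/-- At height `(k-1)/(4πm)` the normalized value of `f_k` is `λ(m)` up to `O(1/k)`. -/
theorem HeckeMult.exists_scale_approx {lam : ℕ → ℝ} (h : HeckeMult lam) {k m : ℕ} (hk : 3 ≤ k)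
    (hm : 1 ≤ m) (hkm : √(k * Real.log k) ≤ ((k : ℝ) - 1) / 2 / (2 * Real.pi * m)) :
    ∃ c : ℝ, 0 < c ∧ |c * fkAxis k lam (((k : ℝ) - 1) / 2 / (2 * Real.pi * m)) - lam m| ≤
      1 / k * ∑' n : ℕ, 1 / (((n + 1 : ℕ) : ℝ) ^ 2) := by
  have hk' : (3 : ℝ) ≤ k := by exact_mod_cast hk
  have hm' : (1 : ℝ) ≤ m := by exact_mod_cast hm
  have hpi := Real.pi_pos
  set κ := ((k : ℝ) - 1) / 2 with hκ
  have hκ1 : 1 ≤ κ := by rw [hκ]; linarith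
  refine ⟨(1 / (m : ℝ)) ^ κ * Real.exp κ, by positivity, ?_⟩
  set g : ℕ → ℝ := fun n => lam (n + 1) * ((((n + 1 : ℕ) : ℝ) / m) ^ κ *
      Real.exp (-(κ * (((n + 1 : ℕ) : ℝ) / m - 1)))) with hg
  have hterm : ∀ n : ℕ, (1 / (m : ℝ)) ^ κ * Real.exp κ * (lam (n + 1) *
      (((n + 1 : ℕ) : ℝ) ^ κ * Real.exp (-(2 * Real.pi * (n + 1 : ℕ) *
        (κ / (2 * Real.pi * m)))))) = g n := by
    intro n
    have h1 : (((n + 1 : ℕ) : ℝ) / m) ^ κ = (1 / (m : ℝ)) ^ κ * ((n + 1 : ℕ) : ℝ) ^ κ := by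
      rw [← Real.mul_rpow (by positivity) (by positivity)]; ring_nf
    have h2 : Real.exp (-(κ * (((n + 1 : ℕ) : ℝ) / m - 1))) = Real.exp κ *
        Real.exp (-(2 * Real.pi * (n + 1 : ℕ) * (κ / (2 * Real.pi * m)))) := by
      rw [← Real.exp_add]
      congr 1
      field_simp
      ring
    simp only [hg]
    rw [h1, h2]
    ring
  have hsum : Summable g := by
    have hy : 0 < κ / (2 * Real.pi * m) := by positivity
    have := Summable.of_norm_bounded (summable_pow_mul_exp_succ k hy)
      (fun n => h.norm_term_le k le_rfl n)
    refine (this.mul_left ((1 / (m : ℝ)) ^ κ * Real.exp κ)).congr fun n => ?_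
    exact hterm n
  have hval : (1 / (m : ℝ)) ^ κ * Real.exp κ * fkAxis k lam (κ / (2 * Real.pi * m)) = ∑' n, g n := by
    unfold fkAxis
    rw [← tsum_mul_left]
    exact tsum_congr hterm
  have hZ : Summable fun n : ℕ => 1 / (((n + 1 : ℕ) : ℝ) ^ 2) :=
    (summable_nat_add_iff 1).mpr (Real.summable_one_div_nat_pow.mpr one_lt_two)
  obtain ⟨m, rfl⟩ : ∃ j, m = j + 1 := ⟨m - 1, by omega⟩
  have hgm : g m = lam (m + 1) := by
    simp only [hg]
    rw [div_self (by positivity)]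
    simp
  rw [hval, hsum.tsum_eq_add_tsum_ite m, hgm, add_sub_cancel_left, ← tsum_mul_left,
    ← Real.norm_eq_abs]
  refine tsum_of_norm_bounded (hZ.mul_left (1 / (k : ℝ))).hasSum fun n => ?_
  split_ifs with hnm
  · simp only [norm_zero]; positivity
  · rw [hg, norm_mul, Real.norm_eq_abs, Real.norm_of_nonneg (by positivity)]
    exact h.off_peak_le hk hm (Nat.succ_le_succ (Nat.zero_le n)) (by omega) hkm

theorem HeckeMult.exists_zero_between {lam : ℕ → ℝ} (h : HeckeMult lam) {k a b : ℕ} {δ : ℝ}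
    (hk : 3 ≤ k) (ha : 1 ≤ a) (hab : a ≤ b)
    (hkb : √(k * Real.log k) ≤ ((k : ℝ) - 1) / 2 / (2 * Real.pi * b))
    (hδ : 1 / k * ∑' n : ℕ, 1 / (((n + 1 : ℕ) : ℝ) ^ 2) < δ)
    (hla : δ ≤ lam a) (hlb : lam b ≤ -δ) :
    ∃ y : ℝ, ((k : ℝ) - 1) / 2 / (2 * Real.pi * b) ≤ y ∧
      y ≤ ((k : ℝ) - 1) / 2 / (2 * Real.pi * a) ∧ fk k lam ((y : ℝ) * Complex.I) = 0 := by
  have hk' : (3 : ℝ) ≤ k := by exact_mod_cast hk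
  have ha' : (1 : ℝ) ≤ a := by exact_mod_cast ha
  have hab' : (a : ℝ) ≤ b := by exact_mod_cast hab
  have hb' : (1 : ℝ) ≤ b := ha'.trans hab'
  have hpi := Real.pi_pos
  have hκ : 0 < ((k : ℝ) - 1) / 2 := by linarith
  have hle : ((k : ℝ) - 1) / 2 / (2 * Real.pi * b) ≤ ((k : ℝ) - 1) / 2 / (2 * Real.pi * a) := by
    gcongr
  obtain ⟨c, hc, hca⟩ := h.exists_scale_approx hk ha (hkb.trans hle)
  obtain ⟨e, he, heb⟩ := h.exists_scale_approx hk (ha.trans hab) hkb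
  have hA : 0 ≤ fkAxis k lam (((k : ℝ) - 1) / 2 / (2 * Real.pi * a)) := by
    have := (abs_le.mp hca).1
    exact (pos_of_mul_pos_right (by linarith) hc.le).le
  have hB : fkAxis k lam (((k : ℝ) - 1) / 2 / (2 * Real.pi * b)) ≤ 0 := by
    have := (abs_le.mp heb).2
    by_contra! hcon
    have := mul_pos he hcon
    linarith
  obtain ⟨y, hy, hy0⟩ := intermediate_value_Icc hle
    (h.continuousOn_fkAxis k (by positivity)) ⟨hB, hA⟩
  exact ⟨y, hy.1, hy.2, by rw [fk_mul_I, hy0, Complex.ofReal_zero]⟩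

theorem HeckeMult.exists_zeros {lam : ℕ → ℝ} (h : HeckeMult lam) {k N J : ℕ} {ε : ℝ}
    (hk : 3 ≤ k) (hε : 0 < ε) (hε1 : ε ≤ 1)
    (hδ : 1 / k * ∑' n : ℕ, 1 / (((n + 1 : ℕ) : ℝ) ^ 2) < ε / 4)
    (hN : IsPrimePow N) (hlN : lam N ≤ -ε)
    (hJ : √(k * Real.log k) * (2 * Real.pi * (N * 2402 ^ (2 * J))) ≤ ((k : ℝ) - 1) / 2) :
    ∃ S : Finset ℝ, (∀ y ∈ S, √(k * Real.log k) ≤ y ∧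
      fk k lam ((y : ℝ) * Complex.I) = 0) ∧ S.card = J := by
  have hk' : (3 : ℝ) ≤ k := by exact_mod_cast hk
  have hpi := Real.pi_pos
  obtain ⟨p, e, hp, he, rfl⟩ := hN
  rw [← Nat.prime_iff] at hp
  set N := p ^ e with hNdef
  have hN1 : (1 : ℝ) ≤ N := by
    exact_mod_cast Nat.one_le_iff_ne_zero.mpr (pow_ne_zero e hp.ne_zero)
  have key : ∀ j : Fin J, ∃ y : ℝ, (√(k * Real.log k) ≤ y ∧
      fk k lam ((y : ℝ) * Complex.I) = 0) ∧
      ((k : ℝ) - 1) / 2 / (2 * Real.pi) < y * (N * 2402 ^ (2 * (j : ℕ) + 2)) ∧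
      y * (N * 2402 ^ (2 * (j : ℕ))) ≤ ((k : ℝ) - 1) / 2 / (2 * Real.pi) := by
    intro j
    have hpow : ∀ i : ℕ, (1 : ℝ) ≤ 2402 ^ i := fun i => one_le_pow₀ (by norm_num)
    obtain ⟨a, -, ha1, ha2, ha3⟩ := h.exists_pos_near hp
      (one_le_mul_of_one_le_of_one_le hN1 (hpow (2 * (j : ℕ))))
    obtain ⟨b, hbp, hb1, hb2, hb3⟩ := h.exists_pos_near hp (hpow (2 * (j : ℕ) + 1))
    have hNb : (N : ℝ) * 2402 ^ (2 * (j : ℕ) + 1) ≤ ((N * b : ℕ) : ℝ) := by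
      push_cast; gcongr
    have hNb2 : ((N * b : ℕ) : ℝ) < N * 2402 ^ (2 * (j : ℕ) + 2) := by
      push_cast
      rw [pow_succ (2402 : ℝ) (2 * (j : ℕ) + 1), mul_comm _ (2402 : ℝ)]
      gcongr
    have ha1' : 1 ≤ a := by
      have : (1 : ℝ) ≤ a := (one_le_mul_of_one_le_of_one_le hN1 (hpow _)).trans ha1
      exact_mod_cast this
    have hab : (a : ℝ) ≤ ((N * b : ℕ) : ℝ) := by
      refine (ha2.le.trans (le_of_eq ?_)).trans hNb
      ring
    have hlb : lam (N * b) ≤ -(ε / 4) := by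
      rw [h.2.1 N b ((hbp.symm).pow_left e)]
      nlinarith
    have hNbpos : (0 : ℝ) < ((N * b : ℕ) : ℝ) := lt_of_lt_of_le (by positivity) hNb
    have hkb : √(k * Real.log k) ≤ ((k : ℝ) - 1) / 2 / (2 * Real.pi * ((N * b : ℕ) : ℝ)) := by
      rw [le_div_iff₀ (by positivity)]
      refine le_trans ?_ hJ
      gcongr
      refine hNb2.le.trans ?_
      have := j.2
      gcongr
      · norm_num
      · omega
    obtain ⟨y, hy1, hy2, hy3⟩ := h.exists_zero_between hk ha1' (by exact_mod_cast hab) hkb hδ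
      (by linarith) hlb
    have hy0 : 0 < y := lt_of_lt_of_le (div_pos (by linarith) (by positivity)) hy1
    refine ⟨y, ⟨hkb.trans hy1, hy3⟩, ?_, ?_⟩
    · rw [← div_div, div_le_iff₀ hNbpos] at hy1
      exact hy1.trans_lt (by gcongr)
    · have ha0 : (0 : ℝ) < a := by exact_mod_cast ha1'
      rw [← div_div, le_div_iff₀ ha0] at hy2
      exact le_trans (by gcongr) hy2
  choose y hy hlow hup using key
  have hpos : ∀ j, 0 < y j := fun j => by
    have h1 : 0 < ((k : ℝ) - 1) / 2 / (2 * Real.pi) := div_pos (by linarith) (by positivity)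
    exact pos_of_mul_pos_left (h1.trans (hlow j)) (by positivity)
  have hanti : StrictAnti y := by
    intro i j hij
    have hij' : 2 * (i : ℕ) + 2 ≤ 2 * (j : ℕ) := by
      have : (i : ℕ) < j := hij
      omega
    have h1 : y j * (N * 2402 ^ (2 * (i : ℕ) + 2)) ≤ y j * (N * 2402 ^ (2 * (j : ℕ))) := by
      have := hpos j
      gcongr
      norm_num
    exact lt_of_mul_lt_mul_right (h1.trans_lt ((hup j).trans_lt (hlow i))) (by positivity)
  refine ⟨Finset.univ.image y, ?_, ?_⟩
  · intro z hz
    obtain ⟨j, -, rfl⟩ := Finset.mem_image.mp hz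
    exact hy j
  · rw [Finset.card_image_of_injective _ hanti.injective, Finset.card_univ, Fintype.card_fin]

theorem eventually_rpow_mul_sqrt_log_le (A : ℝ) (hA : 0 ≤ A) :
    ∀ᶠ x : ℝ in Filter.atTop,
      √(x * Real.log x) * (A * x ^ (0.4973 : ℝ)) ≤ (x - 1) / 2 := by
  have h1 := (isLittleO_log_rpow_atTop (by norm_num : (0 : ℝ) < 0.001)).bound one_pos
  have h2 := (tendsto_rpow_atTop (by norm_num : (0 : ℝ) < 0.0022)).eventually_ge_atTop (4 * A)
  filter_upwards [h1, h2, Filter.eventually_ge_atTop 2] with x hx1 hx2 hx3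
  have hx0 : 0 < x := by linarith
  have hlog : Real.log x ≤ x ^ (0.001 : ℝ) := by
    rw [Real.norm_of_nonneg (by positivity : 0 ≤ x ^ (0.001 : ℝ)), one_mul] at hx1
    exact (Real.le_norm_self _).trans hx1
  have hs : √(x * Real.log x) ≤ x ^ (0.5005 : ℝ) := by
    refine Real.sqrt_le_iff.mpr ⟨by positivity, ?_⟩
    calc x * Real.log x ≤ x ^ (1 : ℝ) * x ^ (0.001 : ℝ) := by rw [Real.rpow_one]; gcongr
      _ = (x ^ (0.5005 : ℝ)) ^ 2 := by
        rw [← Real.rpow_add hx0, ← Real.rpow_mul_natCast hx0.le]; norm_num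
  calc √(x * Real.log x) * (A * x ^ (0.4973 : ℝ))
      ≤ x ^ (0.5005 : ℝ) * (x ^ (0.0022 : ℝ) / 4 * x ^ (0.4973 : ℝ)) := by
        gcongr; linarith
    _ = x ^ (0.5005 + 0.0022 + 0.4973 : ℝ) / 4 := by
        rw [Real.rpow_add hx0, Real.rpow_add hx0]; ring
    _ = x / 4 := by norm_num
    _ ≤ (x - 1) / 2 := by linarith

/-- For every `ε₀ > 0` there are `C > 0` and `K` such that for every even `k ≥ K` and
every Hecke-multiplicative `λ` admitting a prime power `n̂ < k^0.4963` with
`λ(n̂) ≤ -ε₀`, `f_k` has at least `C log k` zeros on the segment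
`δ₁ = {Re z = 0, Im z ≥ √(k log k)}`. -/
theorem stmt_13 :
    ∀ ε₀ : ℝ, 0 < ε₀ →
      ∃ C K : ℝ, 0 < C ∧
        ∀ k : ℕ, Even k → K ≤ (k : ℝ) →
          ∀ lam : ℕ → ℝ, HeckeMult lam →
            (∃ n : ℕ, IsPrimePow n ∧ (n : ℝ) < (k : ℝ) ^ (0.4963 : ℝ) ∧ lam n ≤ -ε₀) →
            ∃ S : Finset ℝ,
              (∀ y ∈ S, Real.sqrt (k * Real.log k) ≤ y ∧
                fk k lam ((y : ℝ) * Complex.I) = 0) ∧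
              C * Real.log k ≤ (S.card : ℝ) := by
  intro ε₀ hε₀
  set ε := min ε₀ 1 with hε
  have hεpos : 0 < ε := lt_min hε₀ one_pos
  set Z : ℝ := ∑' n : ℕ, 1 / (((n + 1 : ℕ) : ℝ) ^ 2) with hZ
  have hlogB : 0 < Real.log 2402 := Real.log_pos (by norm_num)
  obtain ⟨K, hK⟩ := Filter.eventually_atTop.mp
    (eventually_rpow_mul_sqrt_log_le (2 * Real.pi * 2402 ^ 2) (by positivity))
  refine ⟨0.001 / (2 * Real.log 2402), max K (max 3 (4 * Z / ε + 1)), by positivity, ?_⟩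
  rintro k - hk lam h ⟨N, hN, hNk, hlN⟩
  have hkK : K ≤ (k : ℝ) := (le_max_left _ _).trans hk
  have hk3 : (3 : ℝ) ≤ k := (le_max_left _ _).trans ((le_max_right _ _).trans hk)
  have hkZ : 4 * Z / ε + 1 ≤ k := (le_max_right _ _).trans ((le_max_right _ _).trans hk)
  have hk0 : (0 : ℝ) < k := by linarith
  have hlog : 0 ≤ Real.log k := Real.log_nonneg (by linarith)
  set t := 0.001 / (2 * Real.log 2402) * Real.log k with ht
  have ht0 : 0 ≤ t := by positivity
  have hpow : (2402 : ℝ) ^ (2 * ⌈t⌉₊) ≤ 2402 ^ 2 * (k : ℝ) ^ (0.001 : ℝ) := by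
    have h1 : ((2 * ⌈t⌉₊ : ℕ) : ℝ) ≤ 2 + 2 * t := by
      push_cast
      linarith [Nat.ceil_lt_add_one ht0]
    calc (2402 : ℝ) ^ (2 * ⌈t⌉₊) = (2402 : ℝ) ^ ((2 * ⌈t⌉₊ : ℕ) : ℝ) :=
          (Real.rpow_natCast _ _).symm
      _ ≤ (2402 : ℝ) ^ (2 + 2 * t) := Real.rpow_le_rpow_of_exponent_le (by norm_num) h1
      _ = 2402 ^ 2 * (k : ℝ) ^ (0.001 : ℝ) := by
          rw [Real.rpow_add (by norm_num), Real.rpow_two, Real.rpow_def_of_pos hk0,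
            Real.rpow_def_of_pos (by norm_num) (2 * t)]
          congr 2
          rw [ht]
          field_simp
  obtain ⟨S, hS, hcard⟩ := h.exists_zeros (J := ⌈t⌉₊) (N := N) (ε := ε)
    (by exact_mod_cast hk3) hεpos (min_le_right _ _)
    (by
      rw [← hZ, one_div_mul_eq_div, div_lt_iff₀ hk0]
      have : 4 * Z / ε < k := by linarith
      rw [div_lt_iff₀ hεpos] at this
      linarith)
    hN (hlN.trans (neg_le_neg (min_le_left _ _)))
    (by
      refine le_trans ?_ (hK k hkK)
      calc √(k * Real.log k) * (2 * Real.pi * (N * 2402 ^ (2 * ⌈t⌉₊)))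
          ≤ √(k * Real.log k) * (2 * Real.pi * ((k : ℝ) ^ (0.4963 : ℝ) *
              (2402 ^ 2 * (k : ℝ) ^ (0.001 : ℝ)))) := by gcongr
        _ = √(k * Real.log k) * (2 * Real.pi * 2402 ^ 2 *
              (k : ℝ) ^ (0.4963 + 0.001 : ℝ)) := by
            rw [Real.rpow_add hk0]; ring
        _ = _ := by norm_num)
  refine ⟨S, hS, ?_⟩
  rw [hcard]
  exact Nat.le_ceil t
end
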